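/- arXiv:2508.18247 — 2 statements merged into one kernel-verified Lean document; each statement's English description precedes it below -/
import Mathlib

section
/- Let Λ ⊆ ℂ be a lattice, let s ∈ ℂ satisfy ns ∉ Λ for every integer n ≥ 1, let R be a pinning, and let f be an elliptic function for Λ. The following are equivalent: (1) there exist N ∈ ℕ and constants a₀, …, a_N ∈ ℂ, not all zero, such that Σ_{i=0}^{N} a_i·f^{(i)} is elliptically summable; (2) there exist α ∈ ℂ and an elliptic function f* that is analytic on ℂ ∖ ((α+Λ) ∪ (α+s+Λ)) and has at worst simple poles at points of (α+Λ) ∪ (α+s+Λ), such that f* − f is elliptically summable; (3) Σ_{n∈ℤ} c_k(f, r+ns) = 0 for every r ∈ R and every k ≥ 1. -/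
open Filter Topology Set

/-- The Weierstrass zeta function of a lattice `L ⊆ ℂ`. -/
noncomputable def wzeta (L : Set ℂ) (z : ℂ) : ℂ :=
  1 / z + ∑' l : ↥(L \ {0}), (1 / (z - (l : ℂ)) + 1 / (l : ℂ) + z / (l : ℂ) ^ 2)

/-- `L` is a lattice in `ℂ`. -/
def IsLattice (L : Set ℂ) : Prop :=
  ∃ ω₁ ω₂ : ℂ, LinearIndependent ℝ ![ω₁, ω₂] ∧
    L = {z : ℂ | ∃ m n : ℤ, z = (m : ℂ) * ω₁ + (n : ℂ) * ω₂}

/-- `F` extends analytically to the point `α`. -/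
def ExtAnalyticAt (F : ℂ → ℂ) (α : ℂ) : Prop :=
  ∃ g : ℂ → ℂ, AnalyticAt ℂ g α ∧ ∀ᶠ z in 𝓝[≠] α, F z = g z

/-- `f` is an elliptic function for the lattice `L`: meromorphic on `ℂ` and `L`-periodic. -/
def IsElliptic (L : Set ℂ) (f : ℂ → ℂ) : Prop :=
  MeromorphicOn f Set.univ ∧
    ∀ lam ∈ L, ∀ z : ℂ, AnalyticAt ℂ f z → f (z + lam) = f z

/-- `c : ℕ → ℂ` is the family of principal part coefficients of `f` at `α`
(`c k` is the coefficient of `1/(z-α)^k`; `c 0` is irrelevant and set to `0`). -/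
def IsPrincPart (f : ℂ → ℂ) (α : ℂ) (c : ℕ → ℂ) : Prop :=
  c 0 = 0 ∧ (Function.support c).Finite ∧
    ExtAnalyticAt (fun z => f z - ∑ᶠ k : ℕ, c k / (z - α) ^ k) α

/-- `R` is a pinning: `(r, n, λ) ↦ r + n s + λ` is a bijection from `R × ℤ × L` onto `ℂ`. -/
def IsPinning (L : Set ℂ) (s : ℂ) (R : Set ℂ) : Prop :=
  ∀ z : ℂ, ∃! p : ℂ × ℤ × ℂ, p.1 ∈ R ∧ p.2.2 ∈ L ∧ z = p.1 + (p.2.1 : ℂ) * s + p.2.2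


/-- `f` is elliptically summable: `f = τ(g) − g` for some elliptic `g`,
where `τ(g)(z) = g(z+s)`. -/
def EllSummable (L : Set ℂ) (s : ℂ) (f : ℂ → ℂ) : Prop :=
  ∃ g : ℂ → ℂ, IsElliptic L g ∧
    ∀ z : ℂ, AnalyticAt ℂ g z → AnalyticAt ℂ g (z + s) → f z = g (z + s) - g z


open Polynomial in
/-- The polynomial `p`, without constant term, evaluated at `(z - α)⁻¹`, is the principal part
of `f` at `α`. -/
def HasPP (f : ℂ → ℂ) (α : ℂ) (p : ℂ[X]) : Prop :=
  p.coeff 0 = 0 ∧ ExtAnalyticAt (fun z => f z - p.eval (z - α)⁻¹) α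

section PrincipalPart

open Polynomial

theorem AnalyticAt.extAnalyticAt {f : ℂ → ℂ} {α : ℂ} (h : AnalyticAt ℂ f α) :
    ExtAnalyticAt f α :=
  ⟨f, h, Eventually.of_forall fun _ => rfl⟩

theorem ExtAnalyticAt.congr {f g : ℂ → ℂ} {α : ℂ} (h : ExtAnalyticAt f α)
    (hfg : f =ᶠ[𝓝[≠] α] g) : ExtAnalyticAt g α := by
  obtain ⟨F, hF, hfF⟩ := h
  exact ⟨F, hF, by filter_upwards [hfg, hfF] with z h1 h2 using h1 ▸ h2⟩

theorem ExtAnalyticAt.add {f g : ℂ → ℂ} {α : ℂ} (hf : ExtAnalyticAt f α)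
    (hg : ExtAnalyticAt g α) : ExtAnalyticAt (fun z => f z + g z) α := by
  obtain ⟨F, hF, hfF⟩ := hf
  obtain ⟨G, hG, hgG⟩ := hg
  exact ⟨fun z => F z + G z, hF.add hG, by
    filter_upwards [hfF, hgG] with z h1 h2 using by rw [h1, h2]⟩

theorem ExtAnalyticAt.mul {f g : ℂ → ℂ} {α : ℂ} (hf : ExtAnalyticAt f α)
    (hg : ExtAnalyticAt g α) : ExtAnalyticAt (fun z => f z * g z) α := by
  obtain ⟨F, hF, hfF⟩ := hf
  obtain ⟨G, hG, hgG⟩ := hg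
  exact ⟨fun z => F z * G z, hF.mul hG, by
    filter_upwards [hfF, hgG] with z h1 h2 using by rw [h1, h2]⟩

theorem ExtAnalyticAt.meromorphicAt {f : ℂ → ℂ} {α : ℂ} (hf : ExtAnalyticAt f α) :
    MeromorphicAt f α := by
  obtain ⟨F, hF, hfF⟩ := hf
  exact hF.meromorphicAt.congr (EventuallyEq.symm hfF)

theorem extAnalyticAt_iff_order_nonneg {f : ℂ → ℂ} {α : ℂ} (hf : MeromorphicAt f α) :
    ExtAnalyticAt f α ↔ 0 ≤ meromorphicOrderAt f α :=
  hf.meromorphicOrderAt_nonneg_iff.symm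

theorem Polynomial.meromorphicAt_eval_inv (p : ℂ[X]) (α : ℂ) :
    MeromorphicAt (fun w => p.eval (w - α)⁻¹) α := by
  simp_rw [eval_eq_sum_range]
  exact MeromorphicAt.fun_sum fun n _ => (MeromorphicAt.const _ _).mul
    ((((MeromorphicAt.id α).sub (.const α α)).inv).pow n)

theorem HasPP.congr {f g : ℂ → ℂ} {α : ℂ} {p : ℂ[X]} (h : HasPP f α p)
    (hfg : f =ᶠ[𝓝[≠] α] g) : HasPP g α p :=
  ⟨h.1, h.2.congr (by filter_upwards [hfg] with z hz using by rw [hz])⟩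

theorem HasPP.add {f g : ℂ → ℂ} {α : ℂ} {p q : ℂ[X]} (hf : HasPP f α p) (hg : HasPP g α q) :
    HasPP (fun z => f z + g z) α (p + q) :=
  ⟨by simp [hf.1, hg.1], (hf.2.add hg.2).congr (Eventually.of_forall fun z => by
    simp only [eval_add]; ring)⟩

theorem HasPP.const_mul {f : ℂ → ℂ} {α : ℂ} {p : ℂ[X]} (a : ℂ) (hf : HasPP f α p) :
    HasPP (fun z => a * f z) α (a • p) :=
  ⟨by simp [hf.1], ((analyticAt_const (v := a)).extAnalyticAt.mul hf.2).congr
    (Eventually.of_forall fun z => by simp only [eval_smul, smul_eq_mul]; ring)⟩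

theorem HasPP.sub {f g : ℂ → ℂ} {α : ℂ} {p q : ℂ[X]} (hf : HasPP f α p) (hg : HasPP g α q) :
    HasPP (fun z => f z - g z) α (p - q) := by
  have := hf.add (hg.const_mul (-1))
  simpa [sub_eq_add_neg] using this

theorem HasPP.sum {ι : Type*} (S : Finset ι) {f : ι → ℂ → ℂ} {α : ℂ} {p : ι → ℂ[X]}
    (h : ∀ i ∈ S, HasPP (f i) α (p i)) :
    HasPP (fun z => ∑ i ∈ S, f i z) α (∑ i ∈ S, p i) := by
  classical
  induction S using Finset.induction_on with
  | empty => exact ⟨by simp, by simpa using (analyticAt_const (v := (0 : ℂ))).extAnalyticAt⟩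
  | insert i S hi ih =>
    simp_rw [Finset.sum_insert hi]
    exact (h i (by simp)).add (ih fun j hj => h j (by simp [hj]))

theorem hasPP_zero_iff {f : ℂ → ℂ} {α : ℂ} : HasPP f α 0 ↔ ExtAnalyticAt f α := by
  simp [HasPP]

theorem HasPP.meromorphicAt {f : ℂ → ℂ} {α : ℂ} {p : ℂ[X]} (h : HasPP f α p) :
    MeromorphicAt f α :=
  (h.2.meromorphicAt.add (p.meromorphicAt_eval_inv α)).congr
    (Eventually.of_forall fun z => by simp)

theorem HasPP.comp_add {f : ℂ → ℂ} {α : ℂ} {p : ℂ[X]} (s : ℂ) (h : HasPP f (α + s) p) :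
    HasPP (fun z => f (z + s)) α p := by
  obtain ⟨h0, g, hg, hfg⟩ := h
  refine ⟨h0, fun z => g (z + s), hg.comp_of_eq (by fun_prop) rfl, ?_⟩
  have ht : Tendsto (fun z : ℂ => z + s) (𝓝[≠] α) (𝓝[≠] (α + s)) :=
    tendsto_nhdsWithin_iff.mpr ⟨((continuous_id.add continuous_const).tendsto α).mono_left
      nhdsWithin_le_nhds, by filter_upwards [self_mem_nhdsWithin] with z hz; simpa using hz⟩
  filter_upwards [ht.eventually hfg] with z hz
  rw [← hz]
  congr 3
  ring

theorem HasPP.unique {f : ℂ → ℂ} {α : ℂ} {p q : ℂ[X]} (hp : HasPP f α p) (hq : HasPP f α q) :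
    p = q := by
  rw [← sub_eq_zero]
  by_contra hne
  have h := hp.sub hq
  have h0 : (p - q).coeff 0 = 0 := h.1
  obtain ⟨g, hg, hfg⟩ := h.2
  have hdeg : 0 < (p - q).degree := by
    by_contra hd
    rw [eq_C_of_degree_le_zero (not_lt.mp hd), h0] at hne
    simp at hne
  have hinv : Tendsto (fun z : ℂ => ‖(z - α)⁻¹‖) (𝓝[≠] α) atTop := by
    have : Tendsto (fun z : ℂ => z - α) (𝓝[≠] α) (𝓝[≠] 0) :=
      tendsto_nhdsWithin_iff.mpr ⟨by
        have : Tendsto (fun z : ℂ => z - α) (𝓝 α) (𝓝 (α - α)) :=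
          (continuous_id.sub continuous_const).tendsto α
        rw [sub_self] at this
        exact this.mono_left nhdsWithin_le_nhds, by
        filter_upwards [self_mem_nhdsWithin] with z hz; simpa [sub_eq_zero] using hz⟩
    exact tendsto_norm_cobounded_atTop.comp (tendsto_inv₀_nhdsNE_zero.comp this)
  have htop := (p - q).tendsto_norm_atTop hdeg hinv
  have hfin : Tendsto (fun z => ‖eval (z - α)⁻¹ (p - q)‖) (𝓝[≠] α) (𝓝 ‖- g α‖) := by
    refine Tendsto.congr' ?_
      (((hg.continuousAt.tendsto.mono_left nhdsWithin_le_nhds).neg).norm)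
    filter_upwards [hfg] with z hz
    rw [← hz]
    congr 1
    ring
  exact not_tendsto_nhds_of_tendsto_atTop htop _ hfin

theorem MeromorphicAt.exists_hasPP {f : ℂ → ℂ} {α : ℂ} (hf : MeromorphicAt f α) :
    ∃ p, HasPP f α p := by
  obtain ⟨N, hN⟩ := hf
  suffices H : ∀ N : ℕ, ∀ f g : ℂ → ℂ, AnalyticAt ℂ g α →
      (∀ᶠ z in 𝓝[≠] α, (z - α) ^ N * f z = g z) → ∃ p, HasPP f α p from
    H N f _ hN (Eventually.of_forall fun z => by simp)
  intro N
  induction N with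
  | zero =>
    intro f g hg h
    exact ⟨0, by simp, g, hg, by simpa using h⟩
  | succ N ih =>
    intro f g hg h
    have hd : AnalyticAt ℂ (dslope g α) α := by
      obtain ⟨p, hp⟩ := hg
      exact hp.has_fpower_series_dslope_fslope.analyticAt
    obtain ⟨p, hp⟩ := ih (fun z => f z - g α * ((z - α)⁻¹) ^ (N + 1)) (dslope g α) hd (by
      filter_upwards [h, self_mem_nhdsWithin] with z hz hza
      have hza' : z - α ≠ 0 := sub_ne_zero.mpr hza
      rw [dslope_of_ne _ hza, slope_def_field, ← hz, inv_pow]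
      field_simp
      ring)
    refine ⟨p + C (g α) * X ^ (N + 1), by simp [hp.1], hp.2.congr (Eventually.of_forall fun z => ?_)⟩
    simp only [eval_add, eval_mul, eval_C, eval_pow, eval_X]
    ring

/-- The operation on principal parts induced by differentiation. -/
noncomputable def ppDeriv : ℂ[X] →ₗ[ℂ] ℂ[X] :=
  -(LinearMap.mulLeft ℂ (X ^ 2)).comp derivative

theorem ppDeriv_apply (p : ℂ[X]) : ppDeriv p = -(X ^ 2 * derivative p) := rfl

theorem HasPP.deriv {f : ℂ → ℂ} {α : ℂ} {p : ℂ[X]} (h : HasPP f α p) :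
    HasPP (deriv f) α (ppDeriv p) := by
  obtain ⟨-, g, hg, hfg⟩ := h
  refine ⟨by simp [ppDeriv_apply], _root_.deriv g, hg.deriv, ?_⟩
  filter_upwards [eventually_eventually_nhdsWithin.mpr hfg, self_mem_nhdsWithin,
    hg.eventually_analyticAt.filter_mono nhdsWithin_le_nhds] with z hz hza hgz
  have hz' : f =ᶠ[𝓝 z] fun w => g w + p.eval (w - α)⁻¹ := by
    rw [isOpen_compl_singleton.nhdsWithin_eq hza] at hz
    filter_upwards [hz] with w hw
    rw [← hw]; ring
  have hza' : z - α ≠ 0 := sub_ne_zero.mpr hza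
  have h1 : HasDerivAt (fun w : ℂ => (w - α)⁻¹) (-1 / (z - α) ^ 2) z :=
    ((hasDerivAt_id z).sub_const α).fun_inv hza'
  have h2 := (p.hasDerivAt (z - α)⁻¹).comp z h1
  have h3 : HasDerivAt (fun w => g w + p.eval (w - α)⁻¹) _ z :=
    hgz.differentiableAt.hasDerivAt.add h2
  rw [hz'.deriv_eq, h3.deriv, ppDeriv_apply]
  simp only [eval_neg, eval_mul, eval_pow, eval_X]
  field_simp
  ring

open Classical in
/-- The principal part of `f` at `α`, as a polynomial in `(z - α)⁻¹`. -/
noncomputable def pp (f : ℂ → ℂ) (α : ℂ) : ℂ[X] :=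
  if h : ∃ p, HasPP f α p then h.choose else 0

theorem HasPP.pp_eq {f : ℂ → ℂ} {α : ℂ} {p : ℂ[X]} (h : HasPP f α p) : pp f α = p := by
  have h' : ∃ p, HasPP f α p := ⟨p, h⟩
  rw [pp, dif_pos h']
  exact h'.choose_spec.unique h

theorem MeromorphicAt.hasPP {f : ℂ → ℂ} {α : ℂ} (hf : MeromorphicAt f α) :
    HasPP f α (pp f α) := by
  obtain ⟨p, hp⟩ := hf.exists_hasPP
  rwa [hp.pp_eq]

theorem MeromorphicAt.pp_eq_zero_iff {f : ℂ → ℂ} {α : ℂ} (hf : MeromorphicAt f α) :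
    pp f α = 0 ↔ ExtAnalyticAt f α :=
  ⟨fun h => hasPP_zero_iff.mp (h ▸ hf.hasPP), fun h => (hasPP_zero_iff.mpr h).pp_eq⟩

theorem AnalyticAt.pp_eq_zero {f : ℂ → ℂ} {α : ℂ} (hf : AnalyticAt ℂ f α) : pp f α = 0 :=
  hf.meromorphicAt.pp_eq_zero_iff.mpr hf.extAnalyticAt

theorem pp_coeff_zero (f : ℂ → ℂ) (α : ℂ) : (pp f α).coeff 0 = 0 := by
  rw [pp]
  split_ifs with h
  · exact h.choose_spec.1
  · simp

theorem IsPrincPart.coeff_pp {f : ℂ → ℂ} {α : ℂ} {c : ℕ → ℂ} (h : IsPrincPart f α c) (k : ℕ) :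
    (pp f α).coeff k = c k := by
  obtain ⟨h0, hfin, han⟩ := h
  have hcoeff : ∀ k, (∑ j ∈ hfin.toFinset, C (c j) * X ^ j : ℂ[X]).coeff k = c k := by
    intro k
    simp only [finsetSum_coeff, coeff_C_mul, coeff_X_pow, mul_ite, mul_one, mul_zero,
      Finset.sum_ite_eq, Set.Finite.mem_toFinset, Function.mem_support]
    split_ifs with h
    · rfl
    · exact (not_not.mp h).symm
  have hp : HasPP f α (∑ j ∈ hfin.toFinset, C (c j) * X ^ j) := by
    refine ⟨by rw [hcoeff, h0], han.congr (Eventually.of_forall fun z => ?_)⟩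
    simp only
    rw [finsum_eq_sum_of_support_subset (s := hfin.toFinset)]
    · simp [eval_finsetSum, div_eq_mul_inv]
    · intro k hk
      simp only [Function.mem_support, ne_eq, div_eq_zero_iff, not_or] at hk
      simpa using hk.1
  rw [hp.pp_eq, hcoeff]

end PrincipalPart


/-- `f` is `L`-periodic away from a closed discrete set. -/
def AEPeriodic (L : Set ℂ) (f : ℂ → ℂ) : Prop :=
  ∀ lam ∈ L, ∀ᶠ z in codiscrete ℂ, f (z + lam) = f z

section Codiscrete

theorem eventually_codiscrete_iff {P : ℂ → Prop} :
    (∀ᶠ z in codiscrete ℂ, P z) ↔ ∀ x, ∀ᶠ z in 𝓝[≠] x, P z := by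
  rw [Filter.Eventually, codiscrete, mem_codiscreteWithin_iff_forall_mem_nhdsNE]
  simp [Filter.Eventually]

theorem tendsto_add_nhdsNE (α s : ℂ) :
    Tendsto (fun z : ℂ => z + s) (𝓝[≠] α) (𝓝[≠] (α + s)) :=
  tendsto_nhdsWithin_iff.mpr ⟨((continuous_id.add continuous_const).tendsto α).mono_left
    nhdsWithin_le_nhds, by filter_upwards [self_mem_nhdsWithin] with z hz; simpa using hz⟩

theorem Filter.Eventually.codiscrete_add {P : ℂ → Prop} (h : ∀ᶠ z in codiscrete ℂ, P z) (s : ℂ) :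
    ∀ᶠ z in codiscrete ℂ, P (z + s) :=
  eventually_codiscrete_iff.mpr fun x =>
    (tendsto_add_nhdsNE x s).eventually (eventually_codiscrete_iff.mp h (x + s))

theorem Meromorphic.eventually_analyticAt {f : ℂ → ℂ} (hf : Meromorphic f) :
    ∀ᶠ z in codiscrete ℂ, AnalyticAt ℂ f z :=
  eventually_codiscrete_iff.mpr fun x => (hf x).eventually_analyticAt

theorem pp_congr {f g : ℂ → ℂ} {α : ℂ} (hf : MeromorphicAt f α) (hfg : f =ᶠ[𝓝[≠] α] g) :
    pp f α = pp g α :=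
  (hf.hasPP.congr hfg).pp_eq.symm

theorem pp_comp_add {f : ℂ → ℂ} {α s : ℂ} (hf : MeromorphicAt f (α + s)) :
    pp (fun z => f (z + s)) α = pp f (α + s) :=
  (hf.hasPP.comp_add s).pp_eq

theorem Meromorphic.comp_add {f : ℂ → ℂ} (hf : Meromorphic f) (s : ℂ) :
    Meromorphic (fun z => f (z + s)) :=
  fun x => ((hf (x + s)).hasPP.comp_add s).meromorphicAt

theorem IsElliptic.meromorphic {L : Set ℂ} {f : ℂ → ℂ} (hf : IsElliptic L f) : Meromorphic f :=
  meromorphicOn_univ.mp hf.1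

theorem IsElliptic.aePeriodic {L : Set ℂ} {f : ℂ → ℂ} (hf : IsElliptic L f) : AEPeriodic L f :=
  fun lam hlam => hf.meromorphic.eventually_analyticAt.mono fun z hz => hf.2 lam hlam z hz

theorem AEPeriodic.pp_add {L : Set ℂ} {f : ℂ → ℂ} (hp : AEPeriodic L f) (hf : Meromorphic f)
    {lam : ℂ} (hlam : lam ∈ L) (z : ℂ) : pp f (z + lam) = pp f z := by
  rw [← pp_comp_add (hf _)]
  exact pp_congr (hf.comp_add lam z) (eventually_codiscrete_iff.mp (hp lam hlam) z)

theorem exists_isElliptic_normalForm {L : Set ℂ} {f : ℂ → ℂ} (hf : Meromorphic f)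
    (hp : AEPeriodic L f) :
    ∃ g, IsElliptic L g ∧ MeromorphicNFOn g univ ∧ f =ᶠ[codiscrete ℂ] g := by
  have hfg : f =ᶠ[codiscrete ℂ] toMeromorphicNFOn f univ :=
    toMeromorphicNFOn_eqOn_codiscrete hf.meromorphicOn
  have hnf : MeromorphicNFOn (toMeromorphicNFOn f univ) univ :=
    meromorphicNFOn_toMeromorphicNFOn f univ
  refine ⟨_, ⟨hnf.meromorphicOn, fun lam hlam z _ => ?_⟩, hnf, hfg⟩
  have h1 : MeromorphicNFAt (fun w => toMeromorphicNFOn f univ (w + lam)) z :=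
    (hnf (mem_univ (z + lam))).comp_analyticAt (g := fun w => w + lam) (by fun_prop)
  have h2 : ∀ᶠ w in codiscrete ℂ,
      toMeromorphicNFOn f univ (w + lam) = toMeromorphicNFOn f univ w := by
    filter_upwards [hp lam hlam, hfg, hfg.codiscrete_add lam] with w h3 h4 h5
    rw [← h4, ← h5, h3]
  exact ((h1.eventuallyEq_nhdsNE_iff_eventuallyEq_nhds (hnf (mem_univ z))).mp
    (eventually_codiscrete_iff.mp h2 z)).self_of_nhds

theorem MeromorphicNFOn.analyticAt_iff_pp {g : ℂ → ℂ} (hg : MeromorphicNFOn g univ) (z : ℂ) :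
    AnalyticAt ℂ g z ↔ pp g z = 0 := by
  have h := hg (mem_univ z)
  rw [h.meromorphicAt.pp_eq_zero_iff, extAnalyticAt_iff_order_nonneg h.meromorphicAt,
    h.meromorphicOrderAt_nonneg_iff_analyticAt]

end Codiscrete

section Lattice

variable (Λ : PeriodPair)

theorem PeriodPair.exists_isCompact_reps :
    ∃ K : Set ℂ, IsCompact K ∧ ∀ z, ∃ lam ∈ Λ.lattice, z - lam ∈ K := by
  refine ⟨closure (ZSpan.fundamentalDomain Λ.basis),
    (ZSpan.fundamentalDomain_isBounded Λ.basis).isCompact_closure, fun z => ?_⟩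
  refine ⟨(ZSpan.floor Λ.basis z : ℂ), ?_, subset_closure (ZSpan.fract_mem_fundamentalDomain Λ.basis z)⟩
  rw [Λ.lattice_eq_span_range_basis]
  exact (ZSpan.floor Λ.basis z).2

theorem AEPeriodic.exists_finset_pp {Λ : PeriodPair} {f : ℂ → ℂ} (hp : AEPeriodic Λ.lattice f)
    (hf : Meromorphic f) : ∃ T : Finset ℂ, ∀ z, pp f z ≠ 0 → ∃ t ∈ T, z - t ∈ Λ.lattice := by
  obtain ⟨K, hK, hKr⟩ := Λ.exists_isCompact_reps
  have hfin : (K \ {z | AnalyticAt ℂ f z}).Finite :=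
    hK.finite_sdiff_of_mem_codiscreteWithin
      (codiscreteWithin_mono (subset_univ K) hf.eventually_analyticAt)
  refine ⟨hfin.toFinset, fun z hz => ?_⟩
  obtain ⟨lam, hlam, hzK⟩ := hKr z
  refine ⟨z - lam, ?_, by simpa using hlam⟩
  rw [Set.Finite.mem_toFinset]
  refine ⟨hzK, fun han => hz ?_⟩
  rw [← AnalyticAt.pp_eq_zero han, ← hp.pp_add hf hlam (z - lam), sub_add_cancel]

theorem AEPeriodic.eventually_const {Λ : PeriodPair} {f : ℂ → ℂ} (hp : AEPeriodic Λ.lattice f)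
    (hf : Meromorphic f) (h0 : ∀ z, pp f z = 0) : ∃ C, ∀ᶠ z in codiscrete ℂ, f z = C := by
  obtain ⟨g, hg, hnf, hfg⟩ := exists_isElliptic_normalForm hf hp
  have han : ∀ z, AnalyticAt ℂ g z := fun z => by
    rw [hnf.analyticAt_iff_pp, ← pp_congr (hf z) (eventually_codiscrete_iff.mp hfg z), h0]
  have hd : Differentiable ℂ g := fun z => (han z).differentiableAt
  obtain ⟨K, hK, hKr⟩ := Λ.exists_isCompact_reps
  have hb : Bornology.IsBounded (range g) := by
    refine (hK.image hd.continuous).isBounded.subset ?_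
    rintro _ ⟨z, rfl⟩
    obtain ⟨lam, hlam, hzK⟩ := hKr z
    exact ⟨z - lam, hzK, by rw [← hg.2 lam hlam _ (han _), sub_add_cancel]⟩
  refine ⟨g 0, hfg.mono fun z hz => ?_⟩
  rw [hz]
  exact hd.apply_eq_apply_of_bounded hb z 0

end Lattice


namespace PeriodPair

variable (Λ : PeriodPair)

/-- The Weierstrass zeta function without its `1 / z` term. -/
noncomputable def zetaExceptZero (z : ℂ) : ℂ :=
  ∑' l : Λ.lattice, if l.1 = 0 then 0 else 1 / (z - l) + 1 / l.1 + z / l.1 ^ 2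

/-- The Weierstrass zeta function. -/
noncomputable def zeta (z : ℂ) : ℂ := Λ.zetaExceptZero z + 1 / z

theorem zeta_summand_bound {r : ℝ} {z l : ℂ} (hz : ‖z‖ < r) (h : 2 * r ≤ ‖l‖) :
    ‖1 / (z - l) + 1 / l + z / l ^ 2‖ ≤ 2 * r ^ 2 * ‖l‖ ^ (-3 : ℝ) := by
  have hr : 0 < r := (norm_nonneg z).trans_lt hz
  have hl : 0 < ‖l‖ := by linarith
  have hl0 : l ≠ 0 := norm_pos_iff.mp hl
  have hzl : z - l ≠ 0 := by
    rw [sub_ne_zero]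
    rintro rfl
    linarith
  have hzl' : ‖l‖ / 2 ≤ ‖z - l‖ := by
    rw [norm_sub_rev]
    exact .trans (by linarith) (norm_sub_norm_le l z)
  calc ‖1 / (z - l) + 1 / l + z / l ^ 2‖ = ‖z ^ 2 / ((z - l) * l ^ 2)‖ := by
        congr 1
        field_simp
        ring
    _ = ‖z‖ ^ 2 / (‖z - l‖ * ‖l‖ ^ 2) := by simp
    _ ≤ r ^ 2 / (‖l‖ / 2 * ‖l‖ ^ 2) := by gcongr
    _ = 2 * r ^ 2 / ‖l‖ ^ 3 := by field
    _ = _ := by norm_cast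

theorem hasSumLocallyUniformly_zetaExceptZero :
    HasSumLocallyUniformly
      (fun (l : Λ.lattice) (z : ℂ) ↦ if l.1 = 0 then 0 else 1 / (z - l) + 1 / l.1 + z / l.1 ^ 2)
      Λ.zetaExceptZero := by
  refine Λ.hasSumLocallyUniformly_aux (u := fun r l => 2 * r ^ 2 * ‖l‖ ^ (-3 : ℝ)) _
    (fun _ _ ↦ (ZLattice.summable_norm_rpow _ _ (by simp; norm_num)).mul_left _) fun r hr ↦
    Filter.eventually_atTop.mpr ⟨2 * r, ?_⟩
  rintro _ h z hz l rfl
  split_ifs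
  · simp only [norm_zero]
    positivity
  · exact zeta_summand_bound hz h

theorem hasDerivAt_zeta_summand {z l : ℂ} (h : z - l ≠ 0) :
    HasDerivAt (fun w => 1 / (w - l) + 1 / l + w / l ^ 2) (-(1 / (z - l) ^ 2 - 1 / l ^ 2)) z := by
  have h1 : HasDerivAt (fun w : ℂ => 1 / (w - l)) (-1 / (z - l) ^ 2) z := by
    simpa using ((hasDerivAt_id z).sub_const l).fun_inv h
  convert! (h1.add_const (1 / l)).add ((hasDerivAt_id z).div_const (l ^ 2)) using 1
  ring

theorem hasDerivAt_zetaExceptZero {z : ℂ} (hz : z ∈ ((Λ.lattice : Set ℂ) \ {0})ᶜ) :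
    HasDerivAt Λ.zetaExceptZero (-Λ.weierstrassPExcept 0 z) z := by
  have hne : ∀ l : Λ.lattice, l.1 ≠ 0 → ∀ w ∈ ((Λ.lattice : Set ℂ) \ {0})ᶜ, w - l.1 ≠ 0 := by
    intro l hl w hw e
    rw [sub_eq_zero] at e
    exact hw (e ▸ ⟨l.2, hl⟩)
  refine hasDerivAt_of_tendstoLocallyUniformlyOn Λ.isOpen_compl_lattice_sdiff
    (f' := fun s w => ∑ l ∈ s, if l.1 = 0 then 0 else -(1 / (w - l.1) ^ 2 - 1 / l.1 ^ 2))
    (g' := fun w => -Λ.weierstrassPExcept 0 w) (l := atTop) ?_ (.of_forall fun s w hw => ?_)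
    (fun w _ => (Λ.hasSumLocallyUniformly_zetaExceptZero.hasSum (x := w))) hz
  · have := (Λ.hasSumLocallyUniformly_weierstrassPExcept 0).tendstoLocallyUniformlyOn
      (s := ((Λ.lattice : Set ℂ) \ {0})ᶜ)
    refine (this.neg).congr ?_
    intro s w _
    simp only [Pi.neg_apply, ← Finset.sum_neg_distrib]
    refine Finset.sum_congr rfl fun l _ => ?_
    split_ifs <;> simp
  · refine HasDerivAt.fun_sum fun l _ => ?_
    by_cases hl : l.1 = 0
    · simp only [hl, ↓reduceIte]
      exact hasDerivAt_const _ _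
    · simp only [hl, ↓reduceIte]
      exact hasDerivAt_zeta_summand (hne l hl w hw)

theorem analyticAt_zetaExceptZero {z : ℂ} (hz : z ∈ ((Λ.lattice : Set ℂ) \ {0})ᶜ) :
    AnalyticAt ℂ Λ.zetaExceptZero z := by
  have hd : DifferentiableOn ℂ Λ.zetaExceptZero ((Λ.lattice : Set ℂ) \ {0})ᶜ :=
    fun w hw => (Λ.hasDerivAt_zetaExceptZero hw).differentiableAt.differentiableWithinAt
  exact hd.analyticAt (Λ.isOpen_compl_lattice_sdiff.mem_nhds hz)

theorem hasDerivAt_zeta {z : ℂ} (hz : z ∉ Λ.lattice) :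
    HasDerivAt Λ.zeta (-Λ.weierstrassP z) z := by
  have hz0 : z ≠ 0 := fun h => hz (h ▸ Λ.lattice.zero_mem)
  have h1 : HasDerivAt (fun w : ℂ => 1 / w) (-1 / z ^ 2) z := by
    simpa using (hasDerivAt_id z).fun_inv hz0
  have h2 := (Λ.hasDerivAt_zetaExceptZero (z := z) fun h => hz h.1).add h1
  have h3 := Λ.weierstrassPExcept_add 0 z
  simp only [ZeroMemClass.coe_zero] at h3
  convert! h2 using 1
  rw [← h3]
  simp
  ring

theorem analyticAt_zeta {z : ℂ} (hz : z ∉ Λ.lattice) : AnalyticAt ℂ Λ.zeta z := by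
  have hd : DifferentiableOn ℂ Λ.zeta (Λ.lattice : Set ℂ)ᶜ :=
    fun w hw => (Λ.hasDerivAt_zeta hw).differentiableAt.differentiableWithinAt
  exact hd.analyticAt (Λ.isClosed_lattice.isOpen_compl.mem_nhds hz)

theorem isPreconnected_compl_lattice : IsPreconnected (Λ.lattice : Set ℂ)ᶜ := by
  have hc : (Λ.lattice : Set ℂ).Countable := by
    have : Countable Λ.lattice := Λ.latticeEquivProd.toEquiv.countable_iff.mpr inferInstance
    exact Set.to_countable _
  refine (hc.isConnected_compl_of_one_lt_rank ?_).isPreconnected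
  rw [Complex.rank_real_complex]
  norm_num

theorem exists_zeta_add (lam : ℂ) (hlam : lam ∈ Λ.lattice) :
    ∃ η : ℂ, ∀ z ∉ Λ.lattice, Λ.zeta (z + lam) = Λ.zeta z + η := by
  have hadd : ∀ z, z ∉ Λ.lattice → z + lam ∉ Λ.lattice := fun z hz h =>
    hz (by simpa using Λ.lattice.sub_mem h hlam)
  have hder : ∀ z ∉ Λ.lattice, HasDerivAt (fun w => Λ.zeta (w + lam) - Λ.zeta w) 0 z := by
    intro z hz
    convert! ((Λ.hasDerivAt_zeta (hadd z hz)).comp_add_const z lam).sub (Λ.hasDerivAt_zeta hz) using 1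
    have := Λ.weierstrassP_add_coe z ⟨lam, hlam⟩
    simp only at this
    rw [this]
    ring
  obtain ⟨η, hη⟩ := Λ.isClosed_lattice.isOpen_compl.exists_is_const_of_deriv_eq_zero
    Λ.isPreconnected_compl_lattice
    (fun w hw => (hder w hw).differentiableAt.differentiableWithinAt)
    (fun w hw => (hder w hw).deriv)
  exact ⟨η, fun z hz => by rw [← hη z hz]; ring⟩

/-- The quasi-periods of the Weierstrass zeta function. -/
noncomputable def eta (lam : ℂ) : ℂ :=
  Λ.zeta (Λ.ω₁ / 2 + lam) - Λ.zeta (Λ.ω₁ / 2)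

theorem zeta_add {lam : ℂ} (hlam : lam ∈ Λ.lattice) {z : ℂ} (hz : z ∉ Λ.lattice) :
    Λ.zeta (z + lam) = Λ.zeta z + Λ.eta lam := by
  obtain ⟨η, hη⟩ := Λ.exists_zeta_add lam hlam
  rw [hη z hz, eta, hη _ Λ.ω₁_div_two_notMem_lattice]
  ring

theorem eventually_notMem_lattice : ∀ᶠ z in codiscrete ℂ, z ∉ Λ.lattice :=
  eventually_codiscrete_iff.mpr fun x => by
    filter_upwards [mem_nhdsWithin_of_mem_nhds (Λ.compl_lattice_sdiff_singleton_mem_nhds x),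
      self_mem_nhdsWithin] with z hz hzx hmem using hz ⟨hmem, hzx⟩

theorem hasPP_zeta {z : ℂ} (hz : z ∈ Λ.lattice) : HasPP Λ.zeta z Polynomial.X := by
  have h0 : HasPP Λ.zeta 0 Polynomial.X :=
    ⟨by simp, (Λ.analyticAt_zetaExceptZero (z := 0) (by simp)).extAnalyticAt.congr
      (.of_forall fun w => by simp [zeta])⟩
  have h1 := HasPP.comp_add (α := z) (-z) (by simpa using h0)
  have hc : HasPP (fun _ => Λ.eta z) z 0 := hasPP_zero_iff.mpr analyticAt_const.extAnalyticAt
  have h2 := h1.add hc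
  rw [add_zero] at h2
  refine h2.congr ?_
  filter_upwards [eventually_codiscrete_iff.mp Λ.eventually_notMem_lattice z] with w hw
  rw [← Λ.zeta_add hz (fun h => hw (by simpa using Λ.lattice.add_mem h hz)), neg_add_cancel_right]

theorem meromorphic_zeta : Meromorphic Λ.zeta := fun z => by
  by_cases hz : z ∈ Λ.lattice
  · exact (Λ.hasPP_zeta hz).meromorphicAt
  · exact (Λ.analyticAt_zeta hz).meromorphicAt

open Classical in
theorem pp_zeta (z : ℂ) : pp Λ.zeta z = if z ∈ Λ.lattice then Polynomial.X else 0 := by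
  split_ifs with hz
  · exact (Λ.hasPP_zeta hz).pp_eq
  · exact (Λ.analyticAt_zeta hz).pp_eq_zero

end PeriodPair


theorem eq_of_eventuallyEq_codiscrete {f g : ℂ → ℂ} (h : f =ᶠ[codiscrete ℂ] g) {z : ℂ}
    (hf : ContinuousAt f z) (hg : ContinuousAt g z) : f z = g z :=
  tendsto_nhds_unique_of_eventuallyEq (hf.mono_left nhdsWithin_le_nhds)
    (hg.mono_left nhdsWithin_le_nhds) (eventually_codiscrete_iff.mp h z)

section

open Polynomial

theorem tendsto_neg_nhdsNE (α : ℂ) : Tendsto (fun z : ℂ => -z) (𝓝[≠] α) (𝓝[≠] (-α)) :=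
  tendsto_nhdsWithin_iff.mpr ⟨(continuous_neg.tendsto α).mono_left nhdsWithin_le_nhds, by
    filter_upwards [self_mem_nhdsWithin] with z hz; simpa using hz⟩

theorem HasPP.comp_neg {f : ℂ → ℂ} {α : ℂ} {p : ℂ[X]} (h : HasPP f (-α) p) :
    HasPP (fun z => f (-z)) α (p.comp (-X)) := by
  obtain ⟨h0, g, hg, hfg⟩ := h
  refine ⟨by rw [coeff_zero_eq_eval_zero] at h0 ⊢; simpa using h0,
    fun z => g (-z), hg.comp_of_eq (by fun_prop) rfl, ?_⟩
  filter_upwards [(tendsto_neg_nhdsNE α).eventually hfg] with z hz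
  rw [← hz, eval_comp, eval_neg, eval_X, ← inv_neg]
  congr 3
  ring_nf

theorem HasPP.extAnalyticAt_mul {u v : ℂ → ℂ} {α c : ℂ} (hu : HasPP u α (c • X))
    (hv : AnalyticAt ℂ v α) (h0 : v α = 0) : ExtAnalyticAt (fun z => u z * v z) α := by
  obtain ⟨-, U, hU, huU⟩ := hu
  obtain ⟨k, hk, hvk⟩ := (hv.analyticOrderAt_ne_zero.mpr h0 |> fun h =>
    (natCast_le_analyticOrderAt hv (n := 1)).mp (by simpa using Order.one_le_iff_ne_zero.mpr h))
  refine ⟨fun z => U z * v z + c * k z, (hU.mul hv).add (analyticAt_const.mul hk), ?_⟩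
  filter_upwards [huU, hvk.filter_mono nhdsWithin_le_nhds, self_mem_nhdsWithin] with z h1 h2 h3
  have h3' : z - α ≠ 0 := sub_ne_zero.mpr h3
  rw [← h1, h2]
  simp only [eval_smul, eval_X, smul_eq_mul, pow_one]
  field_simp
  ring

end

/-- An elliptic function cannot have a single simple pole modulo the lattice. -/
theorem AEPeriodic.eq_zero_of_simple_pole {Λ : PeriodPair} {F : ℂ → ℂ}
    (hp : AEPeriodic Λ.lattice F) (hF : Meromorphic F) {c : ℂ}
    (hL : ∀ z ∈ Λ.lattice, pp F z = c • Polynomial.X)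
    (hN : ∀ z ∉ Λ.lattice, pp F z = 0) : c = 0 := by
  by_contra hc
  have hneg : ∀ z, z ∈ Λ.lattice ↔ -z ∈ Λ.lattice := fun z => neg_mem_iff.symm
  have hnegc : ∀ {P : ℂ → Prop}, (∀ᶠ z in codiscrete ℂ, P z) → ∀ᶠ z in codiscrete ℂ, P (-z) :=
    fun {P} h => eventually_codiscrete_iff.mpr fun x =>
      (tendsto_neg_nhdsNE x).eventually (eventually_codiscrete_iff.mp h (-x))
  have hH : ∀ z, HasPP (fun z => F z - F (-z)) z
      (pp F z - (pp F (-z)).comp (-Polynomial.X)) := fun z =>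
    (hF z).hasPP.sub (hF (-z)).hasPP.comp_neg
  have hHm : Meromorphic (fun z => F z - F (-z)) := fun z => (hH z).meromorphicAt
  have hHp : AEPeriodic Λ.lattice (fun z => F z - F (-z)) := fun lam hlam => by
    filter_upwards [hp lam hlam, hnegc (hp (-lam) (neg_mem hlam))] with z h1 h2
    rw [h1, neg_add, h2]
  obtain ⟨h, hel, hnf, hHh⟩ := exists_isElliptic_normalForm hHm hHp
  have hppN : ∀ z ∉ Λ.lattice, AnalyticAt ℂ h z := fun z hz => by
    rw [hnf.analyticAt_iff_pp, ← pp_congr (hHm z) (eventually_codiscrete_iff.mp hHh z),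
      (hH z).pp_eq, hN z hz, hN (-z) (by rwa [← hneg])]
    simp
  have hppL : ∀ z ∈ Λ.lattice, HasPP h z ((2 * c) • Polynomial.X) := fun z hz => by
    convert! (hH z).congr (eventually_codiscrete_iff.mp hHh z) using 1
    rw [hL z hz, hL (-z) ((hneg z).mp hz)]
    simp only [Polynomial.smul_comp, Polynomial.X_comp, two_mul, add_smul, smul_neg]
    abel
  have hodd : ∀ z ∉ Λ.lattice, h (-z) = - h z := by
    intro z hz
    refine eq_of_eventuallyEq_codiscrete (f := fun z => h (-z)) (g := fun z => - h z) ?_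
      ((hppN (-z) (by rwa [← hneg])).continuousAt.comp continuous_neg.continuousAt)
      (hppN z hz).continuousAt.neg
    filter_upwards [hHh, hnegc hHh] with w h1 h2
    rw [← h1, ← h2]
    simp
  have hhalf : ∀ a ∉ Λ.lattice, a + a ∈ Λ.lattice → h a = 0 := by
    intro a ha haa
    have h1 := hel.2 _ haa (-a) (hppN _ (by rwa [← hneg]))
    rw [hodd a ha, neg_add_cancel_left] at h1
    exact self_eq_neg.mp h1
  set a := Λ.ω₁ / 2 with ha_def
  set b := Λ.ω₂ / 2 with hb_def
  have ha : a ∉ Λ.lattice := Λ.ω₁_div_two_notMem_lattice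
  have hb : b ∉ Λ.lattice := Λ.ω₂_div_two_notMem_lattice
  have haa : a + a ∈ Λ.lattice := by simpa [ha_def] using Λ.ω₁_mem_lattice
  have hbb : b + b ∈ Λ.lattice := by simpa [hb_def] using Λ.ω₂_mem_lattice
  have hba : b + a ∉ Λ.lattice := by
    have := (Λ.mul_ω₁_add_mul_ω₂_mem_lattice (α := 1 / 2) (β := 1 / 2)).not.mpr (by norm_num)
    convert! this using 1
    simp [ha_def, hb_def]
    ring_nf
  have hshift : ∀ z, z + a ∉ Λ.lattice → AnalyticAt ℂ (fun w => h (w + a)) z := fun z hz =>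
    (hppN _ hz).comp_of_eq (by fun_prop) rfl
  have hper : ∀ z, z ∈ Λ.lattice → h (z + a) = 0 := fun z hz => by
    rw [add_comm, hel.2 z hz a (hppN a ha), hhalf a ha haa]
  have hprod : ∀ z, ExtAnalyticAt (fun w => h w * h (w + a)) z := by
    intro z
    by_cases hz : z ∈ Λ.lattice
    · have hza : z + a ∉ Λ.lattice := fun hm => ha (by simpa using Λ.lattice.sub_mem hm hz)
      exact (hppL z hz).extAnalyticAt_mul (hshift z hza) (hper z hz)
    · by_cases hza : z + a ∈ Λ.lattice
      · have hzz : z + z ∈ Λ.lattice := by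
          have := Λ.lattice.sub_mem (Λ.lattice.add_mem hza hza) haa
          convert! this using 1
          ring
        have := ((hppL _ hza).comp_add a).extAnalyticAt_mul (hppN z hz) (hhalf z hz hzz)
        simpa only [mul_comm] using this
      · exact ((hppN z hz).mul (hshift z hza)).extAnalyticAt
  have hPm : Meromorphic (fun w => h w * h (w + a)) := fun z => (hprod z).meromorphicAt
  have hPp : AEPeriodic Λ.lattice (fun w => h w * h (w + a)) := fun lam hlam => by
    have h1 := hel.aePeriodic lam hlam
    filter_upwards [h1, h1.codiscrete_add a] with z h2 h3
    rw [h2, add_right_comm, h3]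
  obtain ⟨C, hC⟩ := hPp.eventually_const hPm fun z => (hPm z).pp_eq_zero_iff.mpr (hprod z)
  have hC0 : C = 0 := by
    have := eq_of_eventuallyEq_codiscrete (g := fun _ => C) hC (z := b)
      ((hppN b hb).mul (hshift b hba)).continuousAt continuousAt_const
    rw [← this, hhalf b hb hbb, zero_mul]
  subst hC0
  have hpole : ¬ ∀ᶠ z in 𝓝[≠] (0 : ℂ), h z = 0 := fun h0 => by
    have h1 := (hppL 0 Λ.lattice.zero_mem).pp_eq
    rw [pp_congr (g := fun _ => 0) (hnf (mem_univ 0)).meromorphicAt h0,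
      (analyticAt_const).pp_eq_zero] at h1
    have := congrArg (Polynomial.coeff · 1) h1
    simp [hc] at this
  have hne := ((hnf (mem_univ (0 : ℂ))).meromorphicAt.eventually_eq_zero_or_eventually_ne_zero).resolve_left
    hpole
  have hza : ∀ᶠ z in 𝓝[≠] (0 : ℂ), h (z + a) = 0 := by
    filter_upwards [hne, eventually_codiscrete_iff.mp hC 0] with z h1 h2
    exact (mul_eq_zero.mp h2).resolve_left h1
  have hza' : ∀ᶠ z in 𝓝[≠] a, h z = 0 := by
    have := tendsto_add_nhdsNE a (-a)
    rw [add_neg_cancel] at this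
    simpa using this.eventually hza
  have hzero := AnalyticOnNhd.eqOn_zero_of_preconnected_of_frequently_eq_zero
    (f := h) (U := (Λ.lattice : Set ℂ)ᶜ) (fun z hz => hppN z hz)
    Λ.isPreconnected_compl_lattice ha hza'.frequently
  exact hpole (by
    filter_upwards [eventually_codiscrete_iff.mp Λ.eventually_notMem_lattice 0] with z hz
    exact hzero hz)


theorem AEPeriodic.add {L : Set ℂ} {f g : ℂ → ℂ} (hf : AEPeriodic L f) (hg : AEPeriodic L g) :
    AEPeriodic L (fun z => f z + g z) := fun lam hlam => by
  filter_upwards [hf lam hlam, hg lam hlam] with z h1 h2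
  rw [h1, h2]

theorem AEPeriodic.const_mul {L : Set ℂ} {f : ℂ → ℂ} (a : ℂ) (hf : AEPeriodic L f) :
    AEPeriodic L (fun z => a * f z) := fun lam hlam => by
  filter_upwards [hf lam hlam] with z h1
  rw [h1]

theorem AEPeriodic.sub {L : Set ℂ} {f g : ℂ → ℂ} (hf : AEPeriodic L f) (hg : AEPeriodic L g) :
    AEPeriodic L (fun z => f z - g z) := fun lam hlam => by
  filter_upwards [hf lam hlam, hg lam hlam] with z h1 h2
  rw [h1, h2]

theorem AEPeriodic.comp_add {L : Set ℂ} {f : ℂ → ℂ} (hf : AEPeriodic L f) (s : ℂ) :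
    AEPeriodic L (fun z => f (z + s)) := fun lam hlam => by
  filter_upwards [(hf lam hlam).codiscrete_add s] with z h1
  rw [← h1, add_right_comm]

theorem aePeriodic_const (L : Set ℂ) (a : ℂ) : AEPeriodic L (fun _ => a) :=
  fun _ _ => .of_forall fun _ => rfl

theorem Filter.EventuallyEq.deriv_codiscrete {f g : ℂ → ℂ} (h : f =ᶠ[codiscrete ℂ] g) :
    deriv f =ᶠ[codiscrete ℂ] deriv g :=
  eventually_codiscrete_iff.mpr fun x => by
    filter_upwards [eventually_eventually_nhdsWithin.mpr (eventually_codiscrete_iff.mp h x),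
      self_mem_nhdsWithin] with z hz hzx
    rw [(isOpen_compl_singleton (x := x)).nhdsWithin_eq hzx] at hz
    exact EventuallyEq.deriv_eq hz

theorem deriv_add_eq_of_quasiperiodic {f : ℂ → ℂ} {lam c : ℂ}
    (h : ∀ᶠ z in codiscrete ℂ, f (z + lam) = f z + c) :
    ∀ᶠ z in codiscrete ℂ, deriv f (z + lam) = deriv f z := by
  filter_upwards [Filter.EventuallyEq.deriv_codiscrete (f := fun z => f (z + lam))
    (g := fun z => f z + c) h] with z hz
  rwa [deriv_comp_add_const, deriv_add_const] at hz

theorem AEPeriodic.deriv {L : Set ℂ} {f : ℂ → ℂ} (hf : AEPeriodic L f) :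
    AEPeriodic L (deriv f) := fun lam hlam =>
  deriv_add_eq_of_quasiperiodic (c := 0) (by simpa using hf lam hlam)

namespace PeriodPair

variable (Λ : PeriodPair)

theorem aePeriodic_deriv_zeta : AEPeriodic Λ.lattice (deriv Λ.zeta) := fun lam hlam =>
  deriv_add_eq_of_quasiperiodic (c := Λ.eta lam)
    (Λ.eventually_notMem_lattice.mono fun _ hz => Λ.zeta_add hlam hz)

theorem aePeriodic_zeta_sub (s : ℂ) :
    AEPeriodic Λ.lattice (fun z => Λ.zeta (z + s) - Λ.zeta z) := fun lam hlam => by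
  filter_upwards [Λ.eventually_notMem_lattice, Λ.eventually_notMem_lattice.codiscrete_add s]
    with z h1 h2
  rw [add_right_comm, Λ.zeta_add hlam h1, Λ.zeta_add hlam h2]
  ring

open Classical Polynomial in
theorem exists_pp_eq_X_pow (n : ℕ) : ∃ G : ℂ → ℂ, Meromorphic G ∧
    (∀ z, pp G z = if z ∈ Λ.lattice then X ^ (n + 1) else 0) ∧
    AEPeriodic Λ.lattice (_root_.deriv G) ∧
    ∃ B : ℂ, AEPeriodic Λ.lattice (fun z => G z + B * Λ.zeta z) := by
  induction n with
  | zero =>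
    exact ⟨Λ.zeta, Λ.meromorphic_zeta, by simpa using Λ.pp_zeta, Λ.aePeriodic_deriv_zeta, -1,
      by simpa using aePeriodic_const _ 0⟩
  | succ n ih =>
    obtain ⟨G, hG, hpp, hper, -⟩ := ih
    have hper' : AEPeriodic Λ.lattice (fun z => (-1 / (n + 1 : ℂ)) * _root_.deriv G z) :=
      hper.const_mul _
    have h : ∀ z, HasPP (fun z => (-1 / (n + 1 : ℂ)) * _root_.deriv G z) z
        ((-1 / (n + 1 : ℂ)) • ppDeriv (pp G z)) := fun z => (hG z).hasPP.deriv.const_mul _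
    refine ⟨_, fun z => (h z).meromorphicAt, fun z => ?_, hper'.deriv, 0, by simpa using hper'⟩
    rw [(h z).pp_eq, hpp]
    split_ifs
    · have hn : (n + 1 : ℂ) ≠ 0 := Nat.cast_add_one_ne_zero n
      rw [ppDeriv_apply, derivative_X_pow, smul_neg, ← neg_smul, neg_div, neg_neg,
        mul_left_comm, ← smul_eq_C_mul, smul_smul]
      push_cast
      rw [one_div, inv_mul_cancel₀ hn, one_smul]
      ring
    · simp

open Classical Polynomial in
theorem exists_pp_eq (p : ℂ[X]) (hp : p.coeff 0 = 0) : ∃ G : ℂ → ℂ, Meromorphic G ∧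
    (∀ z, pp G z = if z ∈ Λ.lattice then p else 0) ∧
    ∃ B : ℂ, AEPeriodic Λ.lattice (fun z => G z + B * Λ.zeta z) := by
  obtain ⟨q, rfl⟩ := X_dvd_iff.mpr hp
  clear hp
  induction q using Polynomial.induction_on' with
  | add p q hp hq =>
    obtain ⟨G, hG, hpp, B, hB⟩ := hp
    obtain ⟨G', hG', hpp', B', hB'⟩ := hq
    have h := fun z => (hG z).hasPP.add (hG' z).hasPP
    refine ⟨_, fun z => (h z).meromorphicAt, fun z => ?_, B + B', ?_⟩
    · rw [(h z).pp_eq, hpp, hpp']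
      split_ifs <;> ring
    · convert! hB.add hB' using 2
      ring
  | monomial n a =>
    obtain ⟨G, hG, hpp, -, B, hB⟩ := Λ.exists_pp_eq_X_pow n
    have h := fun z => (hG z).hasPP.const_mul a
    refine ⟨_, fun z => (h z).meromorphicAt, fun z => ?_, a * B, ?_⟩
    · rw [(h z).pp_eq, hpp]
      split_ifs
      · rw [← C_mul_X_pow_eq_monomial, smul_eq_C_mul]
        ring
      · simp
    · convert! hB.const_mul a using 2
      ring

open Polynomial in
/-- A Mittag-Leffler theorem for elliptic functions up to a multiple of the zeta function. -/
theorem exists_pp_eq_of_periodic (T : Finset ℂ) (q : ℂ → ℂ[X]) (h0 : ∀ z, (q z).coeff 0 = 0)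
    (hper : ∀ lam ∈ Λ.lattice, ∀ z, q (z + lam) = q z)
    (hT : ∀ z, q z ≠ 0 → ∃ t ∈ T, z - t ∈ Λ.lattice) :
    ∃ K : ℂ → ℂ, Meromorphic K ∧ (∀ z, pp K z = q z) ∧
    ∃ B : ℂ, AEPeriodic Λ.lattice (fun z => K z + B * Λ.zeta z) := by
  classical
  induction T using Finset.induction_on generalizing q with
  | empty =>
    refine ⟨fun _ => 0, fun z => MeromorphicAt.const _ _, fun z => ?_, 0,
      by simpa using aePeriodic_const _ 0⟩
    rw [analyticAt_const.pp_eq_zero]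
    by_contra hz
    obtain ⟨t, ht, -⟩ := hT z (Ne.symm hz)
    simp at ht
  | insert t T _ ih =>
    obtain ⟨G, hG, hpp, B, hB⟩ := Λ.exists_pp_eq (q t) (h0 t)
    have hpp1 : ∀ z, pp (fun z => G (z + -t)) z = if z - t ∈ Λ.lattice then q t else 0 :=
      fun z => by rw [pp_comp_add (hG _), hpp, ← sub_eq_add_neg]
    obtain ⟨K, hK, hKpp, B', hB'⟩ := ih (fun z => q z - pp (fun z => G (z + -t)) z)
      (fun z => by simp [h0, pp_coeff_zero])
      (fun lam hlam z => by
        have : z + lam - t ∈ Λ.lattice ↔ z - t ∈ Λ.lattice := by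
          rw [add_sub_right_comm]
          exact Submodule.add_mem_iff_left _ hlam
        simp only [hper lam hlam, hpp1, this])
      (fun z hz => by
        rw [hpp1] at hz
        split_ifs at hz with h
        · exfalso
          have := hper _ h t
          rw [add_sub_cancel] at this
          exact hz (by rw [this, sub_self])
        · rw [sub_zero] at hz
          obtain ⟨t', ht', hzt⟩ := hT z hz
          rcases Finset.mem_insert.mp ht' with rfl | ht''
          · exact absurd hzt h
          · exact ⟨t', ht'', hzt⟩)
    have h := fun z => (hK z).hasPP.add ((hG.comp_add (-t)) z).hasPP
    refine ⟨_, fun z => (h z).meromorphicAt, fun z => ?_, B' + B, ?_⟩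
    · rw [(h z).pp_eq, hKpp, sub_add_cancel]
    · convert! (hB'.add (hB.comp_add (-t))).sub ((Λ.aePeriodic_zeta_sub (-t)).const_mul B) using 2
      ring

end PeriodPair


section OrbitSum

open Function

variable {M : Type*} [AddCommGroup M]

/-- The sum of `p` over the orbit of `z` under translation by `s`. -/
noncomputable def orbitSum (s : ℂ) (p : ℂ → M) (z : ℂ) : M := ∑ᶠ n : ℤ, p (z + n * s)

/-- The function `p` has finite support modulo `L`. -/
def FinSuppMod (L : Submodule ℤ ℂ) (p : ℂ → M) : Prop :=
  ∃ T : Finset ℂ, ∀ z, p z ≠ 0 → ∃ t ∈ T, z - t ∈ L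

theorem orbitSum_add_int_mul (s : ℂ) (p : ℂ → M) (z : ℂ) (m : ℤ) :
    orbitSum s p (z + m * s) = orbitSum s p z := by
  rw [orbitSum, orbitSum, ← finsum_comp_equiv (Equiv.addLeft m) (f := fun n : ℤ => p (z + n * s))]
  refine finsum_congr fun n => ?_
  simp only [Equiv.coe_addLeft]
  congr 1
  push_cast
  ring

variable {L : Submodule ℤ ℂ} {s : ℂ}

theorem orbitSum_add_of_periodic {p : ℂ → M} (hp : ∀ lam ∈ L, ∀ z, p (z + lam) = p z)
    {lam : ℂ} (hlam : lam ∈ L) (z : ℂ) : orbitSum s p (z + lam) = orbitSum s p z :=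
  finsum_congr fun n => by rw [add_right_comm, hp lam hlam]

theorem int_mul_notMem (hs : ∀ n : ℕ, 1 ≤ n → (n : ℂ) * s ∉ L) {n : ℤ} (hn : (n : ℂ) * s ∈ L) :
    n = 0 := by
  by_contra h
  rcases Int.natAbs_eq n with h1 | h1
  · refine hs n.natAbs (by omega) ?_
    rw [h1] at hn
    simpa using hn
  · refine hs n.natAbs (by omega) ?_
    rw [h1] at hn
    simpa using L.neg_mem hn

theorem eq_of_int_mul_sub_mem (hs : ∀ n : ℕ, 1 ≤ n → (n : ℂ) * s ∉ L) {m n : ℤ} {a : ℂ}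
    (hm : (m : ℂ) * s - a ∈ L) (hn : (n : ℂ) * s - a ∈ L) : m = n := by
  have := L.sub_mem hm hn
  rw [sub_sub_sub_cancel_right, ← sub_mul, ← Int.cast_sub] at this
  exact sub_eq_zero.mp (int_mul_notMem hs this)

theorem FinSuppMod.hasFiniteSupport_orbit (hs : ∀ n : ℕ, 1 ≤ n → (n : ℂ) * s ∉ L) {p : ℂ → M}
    (hp : FinSuppMod L p) (z : ℂ) : HasFiniteSupport (fun n : ℤ => p (z + n * s)) := by
  obtain ⟨T, hT⟩ := hp
  refine Set.Finite.subset (T.finite_toSet.biUnion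
    (t := fun t => {n : ℤ | (n : ℂ) * s - (t - z) ∈ L}) fun t _ =>
    Set.Subsingleton.finite fun m hm n hn => eq_of_int_mul_sub_mem hs hm hn) ?_
  intro n hn
  obtain ⟨t, ht, h⟩ := hT _ hn
  refine Set.mem_biUnion ht ?_
  simp only [Set.mem_ofPred_eq]
  convert! h using 1
  ring

theorem FinSuppMod.orbitSum_sub (hs : ∀ n : ℕ, 1 ≤ n → (n : ℂ) * s ∉ L) {p q : ℂ → M}
    (hp : FinSuppMod L p) (hq : FinSuppMod L q) (z : ℂ) :
    orbitSum s (fun z => p z - q z) z = orbitSum s p z - orbitSum s q z :=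
  finsum_sub_distrib (hp.hasFiniteSupport_orbit hs z) (hq.hasFiniteSupport_orbit hs z)

theorem FinSuppMod.map_orbitSum (hs : ∀ n : ℕ, 1 ≤ n → (n : ℂ) * s ∉ L) {N : Type*}
    [AddCommGroup N] (φ : M →+ N) {p : ℂ → M} (hp : FinSuppMod L p) (z : ℂ) :
    φ (orbitSum s p z) = orbitSum s (fun z => φ (p z)) z :=
  φ.map_finsum (hp.hasFiniteSupport_orbit hs z)

theorem FinSuppMod.comp_add {p : ℂ → M} (hp : FinSuppMod L p) (a : ℂ) :
    FinSuppMod L (fun z => p (z + a)) := by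
  classical
  obtain ⟨T, hT⟩ := hp
  refine ⟨T.image (· - a), fun z hz => ?_⟩
  obtain ⟨t, ht, h⟩ := hT _ hz
  exact ⟨t - a, Finset.mem_image_of_mem _ ht, by convert! h using 1; ring⟩

theorem FinSuppMod.orbitSum_telescope (hs : ∀ n : ℕ, 1 ≤ n → (n : ℂ) * s ∉ L) {u : ℂ → M}
    (hu : FinSuppMod L u) (z : ℂ) : orbitSum s (fun z => u (z + s) - u z) z = 0 := by
  rw [(hu.comp_add s).orbitSum_sub hs hu, sub_eq_zero]
  refine Eq.trans (finsum_congr fun n => ?_) (orbitSum_add_int_mul s u z 1)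
  rw [Int.cast_one, one_mul, add_right_comm]

theorem FinSuppMod.exists_telescope (hs : ∀ n : ℕ, 1 ≤ n → (n : ℂ) * s ∉ L) {p : ℂ → M}
    (hp : FinSuppMod L p) (hper : ∀ lam ∈ L, ∀ z, p (z + lam) = p z)
    (h0 : ∀ z, orbitSum s p z = 0) :
    ∃ q : ℂ → M, FinSuppMod L q ∧ (∀ lam ∈ L, ∀ z, q (z + lam) = q z) ∧
      (∀ z, q (z + s) - q z = p z) ∧
      ∀ S : AddSubgroup M, (∀ z, p z ∈ S) → ∀ z, q z ∈ S := by
  classical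
  have hfin : ∀ (z : ℂ) (P : ℤ → Prop) [DecidablePred P],
      HasFiniteSupport (fun n : ℤ => if P n then p (z + n * s) else 0) := fun z P _ =>
    (hp.hasFiniteSupport_orbit hs z).subset fun n hn => by
      simp only [mem_support] at hn ⊢
      intro h
      simp [h] at hn
  refine ⟨fun z => ∑ᶠ n : ℤ, if n < 0 then p (z + n * s) else 0, ?_, ?_, ?_, ?_⟩
  · obtain ⟨T, hT⟩ := hp
    have hN : ∀ a : ℂ, ∃ N : ℕ, ∀ m : ℤ, (m : ℂ) * s - a ∈ L → m ≤ N := by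
      intro a
      by_cases h : ∃ m : ℤ, (m : ℂ) * s - a ∈ L
      · obtain ⟨m, hm⟩ := h
        exact ⟨m.toNat, fun n hn => (eq_of_int_mul_sub_mem hs hn hm) ▸ Int.self_le_toNat m⟩
      · exact ⟨0, fun m hm => absurd ⟨m, hm⟩ h⟩
    choose N hN using hN
    refine ⟨T.biUnion fun t => T.biUnion fun t' =>
      (Finset.range (N (t' - t) + 1)).image fun j : ℕ => t + j * s, fun z hz => ?_⟩
    have h1 : ∃ n : ℤ, n < 0 ∧ p (z + n * s) ≠ 0 := by
      by_contra! h
      refine hz (finsum_eq_zero_of_forall_eq_zero fun n => ?_)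
      split_ifs with hn
      exacts [h n hn, rfl]
    have h2 : ∃ n : ℤ, 0 ≤ n ∧ p (z + n * s) ≠ 0 := by
      by_contra! h
      refine hz ?_
      refine Eq.trans ?_ (h0 z)
      refine finsum_congr fun n => ?_
      split_ifs with hn
      · rfl
      · exact (h n (not_lt.mp hn)).symm
    obtain ⟨n, hn, hpn⟩ := h1
    obtain ⟨n', hn', hpn'⟩ := h2
    obtain ⟨t, ht, hzt⟩ := hT _ hpn
    obtain ⟨t', ht', hzt'⟩ := hT _ hpn'
    have hle : n' - n ≤ N (t' - t) := hN _ _ (by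
      convert! L.sub_mem hzt' hzt using 1
      push_cast
      ring)
    refine ⟨t + n.natAbs * s, ?_, ?_⟩
    · simp only [Finset.mem_biUnion]
      exact ⟨t, ht, t', ht', Finset.mem_image.mpr ⟨n.natAbs, by rw [Finset.mem_range]; omega, rfl⟩⟩
    · have : (n.natAbs : ℂ) = -(n : ℂ) := by
        rw [← Int.cast_natCast, Int.natCast_natAbs, abs_of_neg hn, Int.cast_neg]
      rw [this]
      convert! hzt using 1
      ring
  · intro lam hlam z
    refine finsum_congr fun n => ?_
    rw [add_right_comm, hper lam hlam]
  · intro z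
    have h1 : (∑ᶠ n : ℤ, if n < 0 then p (z + s + n * s) else 0) =
        ∑ᶠ n : ℤ, if n < 1 then p (z + n * s) else 0 := by
      rw [← finsum_comp_equiv (Equiv.addLeft (1 : ℤ))
        (f := fun n : ℤ => if n < 1 then p (z + n * s) else 0)]
      refine finsum_congr fun n => ?_
      simp only [Equiv.coe_addLeft]
      have : 1 + n < 1 ↔ n < 0 := by omega
      simp only [this]
      congr 2
      push_cast
      ring
    simp only [h1]
    rw [← finsum_sub_distrib (hfin z _) (hfin z _), finsum_eq_single _ 0]
    · simp
    · intro n hn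
      have : n < 1 ↔ n < 0 := by omega
      simp [this]
  · intro S hS z
    refine finsum_induction (· ∈ S) S.zero_mem (fun _ _ => S.add_mem) fun n => ?_
    split_ifs
    exacts [hS _, S.zero_mem]

end OrbitSum


theorem IsElliptic.analyticAt_add {L : Set ℂ} {f : ℂ → ℂ} (hf : IsElliptic L f) {lam : ℂ}
    (hlam : lam ∈ L) {z : ℂ} (hz : AnalyticAt ℂ f z) : AnalyticAt ℂ f (z + lam) := by
  have h1 : AnalyticAt ℂ (fun w => f (w - lam)) (z + lam) :=
    hz.comp_of_eq (f := fun w => w - lam) (by fun_prop) (by simp)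
  have ht : Tendsto (fun w => w - lam) (𝓝 (z + lam)) (𝓝 z) := by
    have : ContinuousAt (fun w => w - lam) (z + lam) := by fun_prop
    simpa [ContinuousAt] using this
  refine h1.congr ?_
  filter_upwards [ht.eventually hz.eventually_analyticAt] with w hw
  rw [← hf.2 lam hlam _ hw, sub_add_cancel]

theorem EllSummable.exists_eventuallyEq {L : Set ℂ} {s : ℂ} {F : ℂ → ℂ} (h : EllSummable L s F) :
    ∃ g, IsElliptic L g ∧ F =ᶠ[codiscrete ℂ] fun z => g (z + s) - g z := by
  obtain ⟨g, hg, hF⟩ := h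
  have han := hg.meromorphic.eventually_analyticAt
  exact ⟨g, hg, by filter_upwards [han, han.codiscrete_add s] with z h1 h2 using hF z h1 h2⟩

/-- Values of `g` on a discrete periodic set may be altered so that the difference equation is
only tested away from that set. -/
theorem EllSummable.of_eventuallyEq {L : Set ℂ} {s : ℂ} {F g : ℂ → ℂ} (hg : Meromorphic g)
    (hgp : AEPeriodic L g) (hF : F =ᶠ[codiscrete ℂ] fun z => g (z + s) - g z) {N : Set ℂ}
    (hN : ∀ᶠ z in codiscrete ℂ, z ∉ N) (hNL : ∀ lam ∈ L, ∀ z ∉ N, z + lam ∉ N)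
    (hFN : ∀ z ∉ N, ContinuousAt F z) : EllSummable L s F := by
  classical
  obtain ⟨g₀, hel, hnf, hgg₀⟩ := exists_isElliptic_normalForm hg hgp
  set g₁ : ℂ → ℂ := fun z => if z ∈ N then g₀ z + 1 else g₀ z with hg₁
  have h₁ : g₀ =ᶠ[codiscrete ℂ] g₁ := by
    filter_upwards [hN] with z hz
    simp [hg₁, hz]
  have key : ∀ z, AnalyticAt ℂ g₁ z → z ∉ N ∧ AnalyticAt ℂ g₀ z := by
    intro z hz
    have h0 : AnalyticAt ℂ g₀ z := by
      rw [hnf.analyticAt_iff_pp, pp_congr (hel.meromorphic z) (eventually_codiscrete_iff.mp h₁ z),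
        hz.pp_eq_zero]
    refine ⟨fun hzN => ?_, h0⟩
    have := eq_of_eventuallyEq_codiscrete h₁ h0.continuousAt hz.continuousAt
    simp [hg₁, hzN] at this
  refine ⟨g₁, ⟨fun z _ => (hel.meromorphic z).congr (eventually_codiscrete_iff.mp h₁ z),
    fun lam hlam z hz => ?_⟩, fun z hz hzs => ?_⟩
  · obtain ⟨hzN, hz0⟩ := key z hz
    simp only [hg₁, hzN, hNL lam hlam z hzN, if_false]
    exact hel.2 lam hlam z hz0
  · obtain ⟨hzN, hz0⟩ := key z hz
    obtain ⟨hzsN, hzs0⟩ := key _ hzs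
    simp only [hg₁, hzN, hzsN, if_false]
    refine eq_of_eventuallyEq_codiscrete (g := fun z => g₀ (z + s) - g₀ z) ?_ (hFN z hzN) ?_
    · filter_upwards [hF, hgg₀, hgg₀.codiscrete_add s] with w h2 h3 h4
      rw [h2, h3, h4]
    · exact (hzs0.continuousAt.comp_of_eq (f := fun w => w + s) (by fun_prop) rfl).sub
        hz0.continuousAt

section PrincipalPartOrbit

open Polynomial

theorem HasPP.iteratedDeriv {f : ℂ → ℂ} {α : ℂ} {p : ℂ[X]} (h : HasPP f α p) (i : ℕ) :
    HasPP (iteratedDeriv i f) α ((ppDeriv ^ i) p) := by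
  induction i with
  | zero => simpa using h
  | succ i ih =>
    rw [iteratedDeriv_succ, pow_succ', Module.End.mul_apply]
    exact ih.deriv

theorem ppDeriv_coeff_zero (p : ℂ[X]) : (ppDeriv p).coeff 0 = 0 := by
  simp [ppDeriv_apply]

theorem ne_zero_and_natDegree_ppDeriv {p : ℂ[X]} (hp : p ≠ 0) (h0 : p.coeff 0 = 0) :
    ppDeriv p ≠ 0 ∧ (ppDeriv p).natDegree = p.natDegree + 1 := by
  have hd : 0 < p.natDegree := by
    by_contra h
    have := eq_C_of_natDegree_eq_zero (Nat.eq_zero_of_not_pos h)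
    rw [h0, C_0] at this
    exact hp this
  have hder : derivative p ≠ 0 := fun h => by
    have := derivative_eq_zero.mp h
    omega
  refine ⟨by simp [ppDeriv_apply, hder], ?_⟩
  rw [ppDeriv_apply, natDegree_neg, natDegree_mul (by simp) hder, natDegree_X_pow,
    natDegree_derivative]
  omega

theorem ne_zero_and_natDegree_ppDeriv_pow {p : ℂ[X]} (hp : p ≠ 0) (h0 : p.coeff 0 = 0) (i : ℕ) :
    (ppDeriv ^ i) p ≠ 0 ∧ ((ppDeriv ^ i) p).coeff 0 = 0 ∧
      ((ppDeriv ^ i) p).natDegree = p.natDegree + i := by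
  induction i with
  | zero => simp [hp, h0]
  | succ i ih =>
    obtain ⟨h1, h2, h3⟩ := ih
    rw [pow_succ', Module.End.mul_apply]
    obtain ⟨h4, h5⟩ := ne_zero_and_natDegree_ppDeriv h1 h2
    exact ⟨h4, ppDeriv_coeff_zero _, by rw [h5, h3, add_assoc]⟩

theorem eq_zero_of_sum_smul_ppDeriv_pow {p : ℂ[X]} (hp : p ≠ 0) (h0 : p.coeff 0 = 0) {a : ℕ → ℂ}
    {N : ℕ} (h : ∑ i ∈ Finset.range N, a i • (ppDeriv ^ i) p = 0) : ∀ i < N, a i = 0 := by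
  induction N with
  | zero => simp
  | succ N ih =>
    have key := ne_zero_and_natDegree_ppDeriv_pow hp h0
    have haN : a N = 0 := by
      have := congrArg (coeff · (p.natDegree + N)) h
      simp only [Finset.sum_range_succ, coeff_add, finsetSum_coeff, coeff_smul, coeff_zero,
        smul_eq_mul] at this
      rw [Finset.sum_eq_zero, zero_add, ← (key N).2.2, coeff_natDegree] at this
      · exact (mul_eq_zero.mp this).resolve_right (leadingCoeff_ne_zero.mpr (key N).1)
      · intro i hi
        rw [coeff_eq_zero_of_natDegree_lt, mul_zero]
        rw [(key i).2.2]
        have := Finset.mem_range.mp hi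
        omega
    rw [Finset.sum_range_succ, haN, zero_smul, add_zero] at h
    intro i hi
    rcases Nat.lt_succ_iff_lt_or_eq.mp hi with h1 | rfl
    exacts [ih h i h1, haN]

theorem ExtAnalyticAt.exists_hasPP_smul_X {f : ℂ → ℂ} {β : ℂ}
    (h : ExtAnalyticAt (fun z => (z - β) * f z) β) : ∃ c : ℂ, HasPP f β (c • X) := by
  obtain ⟨G, ⟨q, hG⟩, hfG⟩ := h
  refine ⟨G β, by simp, dslope G β, hG.has_fpower_series_dslope_fslope.analyticAt, ?_⟩
  filter_upwards [hfG, self_mem_nhdsWithin] with z h1 h2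
  have h3 : z - β ≠ 0 := sub_ne_zero.mpr h2
  rw [dslope_of_ne _ h2, slope_def_field, ← h1]
  simp only [eval_smul, eval_X, smul_eq_mul]
  field_simp

variable {Λ : PeriodPair} {s : ℂ}

theorem AEPeriodic.finSuppMod_pp {f : ℂ → ℂ} (hp : AEPeriodic Λ.lattice f) (hf : Meromorphic f) :
    FinSuppMod Λ.lattice (pp f) :=
  hp.exists_finset_pp hf

theorem orbitSum_pp_eq_zero (hs : ∀ n : ℕ, 1 ≤ n → (n : ℂ) * s ∉ Λ.lattice) {F g : ℂ → ℂ}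
    (hg : Meromorphic g) (hgp : AEPeriodic Λ.lattice g)
    (hF : F =ᶠ[codiscrete ℂ] fun z => g (z + s) - g z) (z : ℂ) : orbitSum s (pp F) z = 0 := by
  rw [← (hgp.finSuppMod_pp hg).orbitSum_telescope hs z]
  congr 1
  funext w
  have h := ((hg (w + s)).hasPP.comp_add s).sub (hg w).hasPP
  exact (h.congr (EventuallyEq.symm (eventually_codiscrete_iff.mp hF w))).pp_eq

theorem orbitSum_pp_iff (hs : ∀ n : ℕ, 1 ≤ n → (n : ℂ) * s ∉ Λ.lattice) {R : Set ℂ}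
    (hR : IsPinning Λ.lattice s R) {f : ℂ → ℂ} (hf : IsElliptic Λ.lattice f) {c : ℂ → ℕ → ℂ}
    (hc : ∀ α, IsPrincPart f α (c α)) :
    (∀ r ∈ R, ∀ k : ℕ, 1 ≤ k → (∑ᶠ n : ℤ, c (r + (n : ℂ) * s) k) = 0) ↔
      ∀ z, orbitSum s (pp f) z = 0 := by
  have hfin := hf.aePeriodic.finSuppMod_pp hf.meromorphic
  have hcoeff : ∀ z k, (orbitSum s (pp f) z).coeff k = ∑ᶠ n : ℤ, c (z + (n : ℂ) * s) k := by
    intro z k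
    refine (hfin.map_orbitSum hs (lcoeff ℂ k).toAddMonoidHom z).trans (finsum_congr fun n => ?_)
    exact (hc _).coeff_pp k
  refine ⟨fun h z => ?_, fun h r _ k _ => by rw [← hcoeff, h, coeff_zero]⟩
  obtain ⟨⟨r, m, lam⟩, ⟨hr, hlam, rfl⟩, -⟩ := hR z
  rw [orbitSum_add_of_periodic (fun l hl => hf.aePeriodic.pp_add hf.meromorphic hl) hlam,
    orbitSum_add_int_mul]
  ext k
  rw [hcoeff, coeff_zero]
  rcases Nat.eq_zero_or_pos k with rfl | hk
  · exact finsum_eq_zero_of_forall_eq_zero fun n => (hc _).1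
  · exact h r hr k hk

/-- If all orbital sums of principal parts vanish, the function is summable up to a constant and a
multiple of a difference of zeta functions. -/
theorem exists_eventuallyEq_of_orbitSum_pp (hs : ∀ n : ℕ, 1 ≤ n → (n : ℂ) * s ∉ Λ.lattice)
    {f : ℂ → ℂ} (hf : Meromorphic f) (hp : AEPeriodic Λ.lattice f)
    (h : ∀ z, orbitSum s (pp f) z = 0) :
    ∃ (B C : ℂ) (g : ℂ → ℂ), Meromorphic g ∧ AEPeriodic Λ.lattice g ∧
      f =ᶠ[codiscrete ℂ] fun z => C + (g (z + s) - g z) - B * (Λ.zeta (z + s) - Λ.zeta z) := by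
  obtain ⟨q, ⟨T, hT⟩, hqper, hq, hS⟩ := (hp.finSuppMod_pp hf).exists_telescope hs
    (fun lam hlam => hp.pp_add hf hlam) h
  have hq0 : ∀ z, (q z).coeff 0 = 0 :=
    hS (lcoeff ℂ 0).toAddMonoidHom.ker (fun z => pp_coeff_zero f z)
  obtain ⟨K, hK, hKq, B, hB⟩ := Λ.exists_pp_eq_of_periodic T q hq0 hqper hT
  have hF : ∀ z, HasPP (fun z => f z - (K (z + s) - K z)) z 0 := fun z => by
    have := (hf z).hasPP.sub (((hK (z + s)).hasPP.comp_add s).sub (hK z).hasPP)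
    rwa [hKq, hKq, hq, sub_self] at this
  have hFp : AEPeriodic Λ.lattice (fun z => f z - (K (z + s) - K z)) := by
    convert! hp.sub (((hB.comp_add s).sub hB).sub ((Λ.aePeriodic_zeta_sub s).const_mul B)) using 2
    ring
  obtain ⟨C, hC⟩ := hFp.eventually_const (fun z => (hF z).meromorphicAt) fun z => (hF z).pp_eq
  refine ⟨B, C, fun z => K z + B * Λ.zeta z, fun z => (hK z).add
    ((MeromorphicAt.const B z).mul (Λ.meromorphic_zeta z)), hB, ?_⟩
  filter_upwards [hC] with z hz
  rw [← hz]
  ring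

end PrincipalPartOrbit


section Summability

open Polynomial

variable {Λ : PeriodPair} {s : ℂ}

theorem orbitSum_pp_eq_zero_of_sum_iteratedDeriv
    (hs : ∀ n : ℕ, 1 ≤ n → (n : ℂ) * s ∉ Λ.lattice) {f : ℂ → ℂ} (hf : IsElliptic Λ.lattice f)
    {N : ℕ} {a : ℕ → ℂ} (ha : ∃ i ≤ N, a i ≠ 0)
    (h : EllSummable Λ.lattice s fun z => ∑ i ∈ Finset.range (N + 1), a i * iteratedDeriv i f z)
    (z : ℂ) : orbitSum s (pp f) z = 0 := by
  obtain ⟨g, hg, hF⟩ := h.exists_eventuallyEq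
  let Φ : ℂ[X] →ₗ[ℂ] ℂ[X] := ∑ i ∈ Finset.range (N + 1), a i • ppDeriv ^ i
  have hΦ : ∀ p, Φ p = ∑ i ∈ Finset.range (N + 1), a i • (ppDeriv ^ i) p := fun p => by
    simp [Φ, LinearMap.sum_apply]
  have hfin := hf.aePeriodic.finSuppMod_pp hf.meromorphic
  have h1 := orbitSum_pp_eq_zero hs hg.meromorphic hg.aePeriodic hF z
  have h2 : Φ (orbitSum s (pp f) z) = 0 := by
    rw [← h1]
    refine (hfin.map_orbitSum hs Φ.toAddMonoidHom z).trans (finsum_congr fun n => ?_)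
    refine Eq.trans (hΦ _) (HasPP.pp_eq ?_).symm
    exact HasPP.sum _ fun i _ => ((hf.meromorphic _).hasPP.iteratedDeriv i).const_mul (a i)
  have h3 : (orbitSum s (pp f) z).coeff 0 = 0 :=
    (hfin.map_orbitSum hs (lcoeff ℂ 0).toAddMonoidHom z).trans
      (finsum_eq_zero_of_forall_eq_zero fun n => pp_coeff_zero f _)
  by_contra hne
  obtain ⟨i, hi, hai⟩ := ha
  rw [hΦ] at h2
  exact hai (eq_zero_of_sum_smul_ppDeriv_pow hne h3 h2 i (Nat.lt_succ_of_le hi))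

theorem ellSummable_deriv_of_orbitSum_pp
    (hs : ∀ n : ℕ, 1 ≤ n → (n : ℂ) * s ∉ Λ.lattice) {f : ℂ → ℂ} (hf : IsElliptic Λ.lattice f)
    (h : ∀ z, orbitSum s (pp f) z = 0) : EllSummable Λ.lattice s (deriv f) := by
  obtain ⟨B, C, g, hg, hgp, hfg⟩ :=
    exists_eventuallyEq_of_orbitSum_pp hs hf.meromorphic hf.aePeriodic h
  refine EllSummable.of_eventuallyEq (g := fun z => deriv g z - B * deriv Λ.zeta z)
    (N := {z | ¬ AnalyticAt ℂ f z})
    (fun z => (hg z).deriv.sub ((MeromorphicAt.const B z).mul (Λ.meromorphic_zeta z).deriv))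
    (hgp.deriv.sub (Λ.aePeriodic_deriv_zeta.const_mul B)) ?_ ?_ ?_ ?_
  · have h1 := hg.eventually_analyticAt
    have h2 := Λ.meromorphic_zeta.eventually_analyticAt
    filter_upwards [hfg.deriv_codiscrete, h1, h1.codiscrete_add s, h2, h2.codiscrete_add s]
      with z h3 h4 h5 h6 h7
    have h8 := h5.differentiableAt.hasDerivAt.comp_add_const z s
    have h9 := h7.differentiableAt.hasDerivAt.comp_add_const z s
    rw [h3, (((hasDerivAt_const z C).fun_add (h8.fun_sub h4.differentiableAt.hasDerivAt)).fun_sub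
      ((h9.fun_sub h6.differentiableAt.hasDerivAt).const_mul B)).deriv]
    ring
  · filter_upwards [hf.meromorphic.eventually_analyticAt] with z hz
    simpa using hz
  · intro lam hlam z hz
    simp only [Set.mem_ofPred_eq, not_not] at hz ⊢
    exact hf.analyticAt_add hlam hz
  · intro z hz
    simp only [Set.mem_ofPred_eq, not_not] at hz
    exact hz.deriv.continuousAt

theorem orbitSum_pp_eq_zero_of_two_poles
    (hs : ∀ n : ℕ, 1 ≤ n → (n : ℂ) * s ∉ Λ.lattice) {f : ℂ → ℂ} (hfm : Meromorphic f)
    (hp : AEPeriodic Λ.lattice f) {α : ℂ}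
    (han : ∀ z, z - α ∉ Λ.lattice → z - (α + s) ∉ Λ.lattice → pp f z = 0)
    {a b : ℂ} (ha : pp f α = a • X) (hb : pp f (α + s) = b • X) (z : ℂ) :
    orbitSum s (pp f) z = 0 := by
  classical
  have hs1 : s ∉ Λ.lattice := by simpa using hs 1 le_rfl
  have hex : ∀ z ∈ Λ.lattice, z + s ∉ Λ.lattice := fun z hz h =>
    hs1 (by simpa using Λ.lattice.sub_mem h hz)
  have hF : ∀ z, HasPP (fun z => f (z + (α + s)) - a * (Λ.zeta (z + s) - Λ.zeta z)) z
      (pp f (z + (α + s)) - a • ((if z + s ∈ Λ.lattice then X else 0) -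
        if z ∈ Λ.lattice then X else 0)) := fun z => by
    have := ((hfm (z + (α + s))).hasPP.comp_add (α + s)).sub
      ((((Λ.meromorphic_zeta (z + s)).hasPP.comp_add s).sub
        (Λ.meromorphic_zeta z).hasPP).const_mul a)
    rwa [Λ.pp_zeta, Λ.pp_zeta] at this
  have hpole : ∀ z, z ∈ Λ.lattice → pp f (z + (α + s)) = b • X := fun z hz => by
    rw [add_comm, hp.pp_add hfm hz, hb]
  have hzero : ∀ z, z ∉ Λ.lattice → pp f (z + (α + s)) - a • ((if z + s ∈ Λ.lattice then X else 0)
      - if z ∈ Λ.lattice then X else 0) = 0 := by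
    intro z hz
    by_cases hzs : z + s ∈ Λ.lattice
    · have : z + (α + s) = α + (z + s) := by ring
      rw [this, hp.pp_add hfm hzs, ha]
      simp [hz, hzs]
    · rw [han]
      · simp [hz, hzs]
      · convert! hzs using 1
        ring_nf
      · simpa using hz
  have hab : b + a = 0 := by
    refine AEPeriodic.eq_zero_of_simple_pole (Λ := Λ)
      ((hp.comp_add (α + s)).sub ((Λ.aePeriodic_zeta_sub s).const_mul a))
      (fun z => (hF z).meromorphicAt) (fun z hz => ?_) (fun z hz => ?_)
    · rw [(hF z).pp_eq, hpole z hz, if_neg (hex z hz), if_pos hz, add_smul, zero_sub, smul_neg,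
        sub_neg_eq_add]
    · rw [(hF z).pp_eq, hzero z hz]
  have htel : pp f = fun w => (fun w => a • (if w - (α + s) ∈ Λ.lattice then X else 0 : ℂ[X])) (w + s)
      - (fun w => a • (if w - (α + s) ∈ Λ.lattice then X else 0 : ℂ[X])) w := by
    funext w
    obtain ⟨z, rfl⟩ : ∃ z, w = z + (α + s) := ⟨w - (α + s), by ring⟩
    have h1 : z + (α + s) + s - (α + s) = z + s := by ring
    simp only [h1, add_sub_cancel_right]
    by_cases hz : z ∈ Λ.lattice
    · rw [hpole z hz, if_neg (hex z hz), if_pos hz, smul_zero, zero_sub, ← neg_smul,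
        eq_neg_of_add_eq_zero_left hab]
    · rw [← smul_sub, ← sub_eq_zero, hzero z hz]
  rw [htel]
  refine FinSuppMod.orbitSum_telescope (L := Λ.lattice) hs ⟨{α + s}, fun w hw => ?_⟩ z
  refine ⟨_, Finset.mem_singleton_self _, ?_⟩
  by_contra h
  simp [h] at hw

theorem exists_two_poles_of_orbitSum_pp
    (hs : ∀ n : ℕ, 1 ≤ n → (n : ℂ) * s ∉ Λ.lattice) {f : ℂ → ℂ} (hf : IsElliptic Λ.lattice f)
    (h : ∀ z, orbitSum s (pp f) z = 0) :
    ∃ fs : ℂ → ℂ, IsElliptic Λ.lattice fs ∧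
      (∀ z, z ∉ Λ.lattice → z + s ∉ Λ.lattice → AnalyticAt ℂ fs z) ∧
      (∀ β, ExtAnalyticAt (fun z => (z - β) * fs z) β) ∧
      EllSummable Λ.lattice s fun z => fs z - f z := by
  classical
  obtain ⟨B, C, g, hg, hgp, hfg⟩ :=
    exists_eventuallyEq_of_orbitSum_pp hs hf.meromorphic hf.aePeriodic h
  have hpp : ∀ z, HasPP (fun z => C - B * (Λ.zeta (z + s) - Λ.zeta z)) z
      (0 - B • ((if z + s ∈ Λ.lattice then X else 0) - if z ∈ Λ.lattice then X else 0)) :=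
    fun z => by
      have := (hasPP_zero_iff.mpr (analyticAt_const (v := C)).extAnalyticAt).sub
        ((((Λ.meromorphic_zeta (z + s)).hasPP.comp_add s).sub
          (Λ.meromorphic_zeta z).hasPP).const_mul B)
      rwa [Λ.pp_zeta, Λ.pp_zeta] at this
  obtain ⟨fs, hel, hnf, hfs⟩ := exists_isElliptic_normalForm (fun z => (hpp z).meromorphicAt)
    ((aePeriodic_const Λ.lattice C).sub ((Λ.aePeriodic_zeta_sub s).const_mul B))
  have hpp' := fun z => (hpp z).congr (eventually_codiscrete_iff.mp hfs z)
  refine ⟨fs, hel, fun z hz hzs => ?_, fun β => ?_, ?_⟩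
  · rw [hnf.analyticAt_iff_pp, (hpp' z).pp_eq]
    simp [hz, hzs]
  · have hc : ∃ c : ℂ, 0 - B • ((if β + s ∈ Λ.lattice then X else 0) -
        if β ∈ Λ.lattice then X else 0) = c • (X : ℂ[X]) := by
      split_ifs
      exacts [⟨0, by simp⟩, ⟨-B, by simp⟩, ⟨B, by simp⟩, ⟨0, by simp⟩]
    obtain ⟨c, hc⟩ := hc
    have h1 := hpp' β
    rw [hc] at h1
    have h2 := h1.extAnalyticAt_mul (v := fun z => z - β) (by fun_prop) (sub_self β)
    simpa only [mul_comm] using h2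
  · refine EllSummable.of_eventuallyEq (g := fun z => (-1) * g z)
      (N := {z | ¬ (AnalyticAt ℂ f z ∧ AnalyticAt ℂ fs z)})
      (fun z => (MeromorphicAt.const _ z).mul (hg z)) (hgp.const_mul _) ?_ ?_ ?_ ?_
    · filter_upwards [hfg, hfs] with z h1 h2
      rw [h1, ← h2]
      ring
    · filter_upwards [hf.meromorphic.eventually_analyticAt, hel.meromorphic.eventually_analyticAt]
        with z h1 h2
      simp [h1, h2]
    · intro lam hlam z hz
      simp only [Set.mem_ofPred_eq, not_not] at hz ⊢
      exact ⟨hf.analyticAt_add hlam hz.1, hel.analyticAt_add hlam hz.2⟩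
    · intro z hz
      simp only [Set.mem_ofPred_eq, not_not] at hz
      exact hz.2.continuousAt.sub hz.1.continuousAt

end Summability

theorem IsLattice.exists_periodPair {L : Set ℂ} (hL : IsLattice L) :
    ∃ Λ : PeriodPair, L = Λ.lattice := by
  obtain ⟨ω₁, ω₂, hind, rfl⟩ := hL
  refine ⟨⟨ω₁, ω₂, hind⟩, ?_⟩
  ext z
  simp only [Set.mem_ofPred_eq, SetLike.mem_coe, PeriodPair.mem_lattice, eq_comm]

theorem stmt15 (L : Set ℂ) (hL : IsLattice L) (s : ℂ)
    (hs : ∀ n : ℕ, 1 ≤ n → (n : ℂ) * s ∉ L)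
    (R : Set ℂ) (hR : IsPinning L s R)
    (f : ℂ → ℂ) (hf : IsElliptic L f)
    (c : ℂ → ℕ → ℂ) (hc : ∀ α : ℂ, IsPrincPart f α (c α)) :
    ((∃ N : ℕ, ∃ a : ℕ → ℂ, (∃ i : ℕ, i ≤ N ∧ a i ≠ 0) ∧
        EllSummable L s (fun z => ∑ i ∈ Finset.range (N + 1), a i * iteratedDeriv i f z)) ↔
      (∀ r ∈ R, ∀ k : ℕ, 1 ≤ k → (∑ᶠ n : ℤ, c (r + (n : ℂ) * s) k) = 0)) ∧
    ((∃ α : ℂ, ∃ fs : ℂ → ℂ, IsElliptic L fs ∧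
        (∀ z : ℂ, (∀ lam ∈ L, z ≠ α + lam ∧ z ≠ α + s + lam) → AnalyticAt ℂ fs z) ∧
        (∀ β : ℂ, (∃ lam ∈ L, β = α + lam ∨ β = α + s + lam) →
          ExtAnalyticAt (fun z => (z - β) * fs z) β) ∧
        EllSummable L s (fun z => fs z - f z)) ↔
      (∀ r ∈ R, ∀ k : ℕ, 1 ≤ k → (∑ᶠ n : ℤ, c (r + (n : ℂ) * s) k) = 0)) := by
  obtain ⟨Λ, rfl⟩ := hL.exists_periodPair
  rw [orbitSum_pp_iff hs hR hf hc]
  refine ⟨⟨?_, fun h => ?_⟩, ?_, fun h => ?_⟩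
  · rintro ⟨N, a, ha, h⟩
    exact orbitSum_pp_eq_zero_of_sum_iteratedDeriv hs hf ha h
  · refine ⟨1, fun i => if i = 1 then 1 else 0, ⟨1, le_rfl, by simp⟩, ?_⟩
    simpa [Finset.sum_range_succ] using ellSummable_deriv_of_orbitSum_pp hs hf h
  · rintro ⟨α, fs, hfs, han, hpole, hsum⟩ z
    obtain ⟨a, ha⟩ := (hpole α ⟨0, Λ.lattice.zero_mem, by simp⟩).exists_hasPP_smul_X
    obtain ⟨b, hb⟩ := (hpole (α + s) ⟨0, Λ.lattice.zero_mem, by simp⟩).exists_hasPP_smul_X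
    have h1 := orbitSum_pp_eq_zero_of_two_poles hs hfs.meromorphic hfs.aePeriodic
      (fun z hz hzs => (han z fun lam hlam =>
        ⟨fun h => hz (by simpa [h] using hlam), fun h => hzs (by simpa [h] using hlam)⟩).pp_eq_zero)
      ha.pp_eq hb.pp_eq z
    obtain ⟨g, hg, hF⟩ := hsum.exists_eventuallyEq
    have h2 := orbitSum_pp_eq_zero hs hg.meromorphic hg.aePeriodic hF z
    have hd := fun z => (hfs.meromorphic z).hasPP.sub (hf.meromorphic z).hasPP
    have hdp := hfs.aePeriodic.sub hf.aePeriodic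
    have h3 : pp f = fun z => pp fs z - pp (fun z => fs z - f z) z := by
      funext w
      rw [(hd w).pp_eq, sub_sub_cancel]
    rw [h3, (hfs.aePeriodic.finSuppMod_pp hfs.meromorphic).orbitSum_sub hs
      (hdp.finSuppMod_pp fun z => (hd z).meromorphicAt), h1, h2, sub_zero]
  · obtain ⟨fs, hfs, han, hpole, hsum⟩ := exists_two_poles_of_orbitSum_pp hs hf h
    refine ⟨-s, fs, hfs, fun z hz => han z (fun hm => ?_) (fun hm => ?_), fun β _ => hpole β, hsum⟩
    · exact (hz z hm).2 (by simp)
    · exact (hz (z + s) hm).1 (by ring)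
end

section
/- Let Λ ⊆ ℂ be a lattice, let s ∈ ℂ satisfy ns ∉ Λ for every integer n ≥ 1, let R be a pinning, and let f be an elliptic function for Λ that is not identically zero. Then the logarithmic derivative f'/f is elliptically summable if and only if: (1) Σ_{n∈ℤ} ν_{r+ns}(f) = 0 for every r ∈ R, and (2) Σ_{r∈R} Σ_{n∈ℤ} n·ν_{r+ns}(f) = 0. -/
open Filter Topology Set

/-- `f` has order exactly `d` at `α`: `z ↦ f(z)/(z-α)^d` extends analytically to `α`
with nonzero value there. -/
def HasOrderAt (f : ℂ → ℂ) (α : ℂ) (d : ℤ) : Prop :=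
  ∃ g : ℂ → ℂ, AnalyticAt ℂ g α ∧ g α ≠ 0 ∧ ∀ᶠ z in 𝓝[≠] α, f z = (z - α) ^ d * g z

/-! ### The theta product -/

/-- There is an entire function `ψ` with `ψ 0 = 1` and `ψ x = (1 - x) ψ (q x)`, namely
`∏ (1 - q ^ n x)`. -/
lemma exists_qProduct {q : ℂ} (hq : ‖q‖ < 1) :
    ∃ ψ : ℂ → ℂ, Differentiable ℂ ψ ∧ ψ 0 = 1 ∧ ∀ x, ψ x = (1 - x) * ψ (q * x) := by
  have hsum : ∀ x : ℂ, Summable fun n : ℕ => ‖-(q ^ n * x)‖ := fun x => by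
    simpa [norm_mul, norm_pow] using
      (summable_geometric_of_lt_one (norm_nonneg q) hq).mul_right ‖x‖
  refine ⟨fun x => ∏' n : ℕ, (1 + -(q ^ n * x)), ?_, by simp, fun x => ?_⟩
  · intro x
    have hprod := ((summable_geometric_of_lt_one (norm_nonneg q) hq).mul_right
      (‖x‖ + 1)).hasProdLocallyUniformlyOn_nat_one_add
      (f := fun (n : ℕ) (y : ℂ) => -(q ^ n * y))
      (K := Metric.ball (0 : ℂ) (‖x‖ + 1)) Metric.isOpen_ball
      (Eventually.of_forall fun n y hy => by
        rw [norm_neg, norm_mul, norm_pow]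
        gcongr
        exact (mem_ball_zero_iff.1 hy).le) (fun n => by fun_prop)
    have hd := hprod.differentiableOn
      (.of_forall fun _ => by
        simpa [Finset.prod_fn] using DifferentiableOn.finsetProd (fun _ _ => by fun_prop))
      Metric.isOpen_ball
    exact hd.differentiableAt (Metric.isOpen_ball.mem_nhds (by simp))
  · have hm : Multipliable fun n : ℕ => (1 + -(q ^ (n + 1) * x)) :=
      multipliable_one_add_of_summable
        ((summable_nat_add_iff (f := fun n : ℕ => ‖-(q ^ n * x)‖) 1).2 (hsum x))
    beta_reduce
    rw [tprod_eq_zero_mul' (f := fun n : ℕ => 1 + -(q ^ n * x)) hm]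
    simp [pow_succ, mul_assoc, sub_eq_add_neg]

/-- The zeros of a function as in `exists_qProduct` are the points `q ^ (-n)`, `n : ℕ`. -/
lemma qProduct_eq_zero_iff {q : ℂ} (hq : ‖q‖ < 1) {ψ : ℂ → ℂ} (hψ : Continuous ψ)
    (h0 : ψ 0 = 1) (hfe : ∀ x, ψ x = (1 - x) * ψ (q * x)) (x : ℂ) :
    ψ x = 0 ↔ ∃ n : ℕ, q ^ n * x = 1 := by
  have hiter : ∀ N : ℕ, ψ x = (∏ k ∈ Finset.range N, (1 - q ^ k * x)) * ψ (q ^ N * x) := by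
    intro N
    induction N with
    | zero => simp
    | succ N ih =>
      rw [Finset.prod_range_succ, ih, hfe (q ^ N * x)]
      ring_nf
  constructor
  · intro hx
    have hlim : Tendsto (fun N : ℕ => ψ (q ^ N * x)) atTop (𝓝 (ψ (0 * x))) :=
      (hψ.tendsto _).comp ((tendsto_pow_atTop_nhds_zero_of_norm_lt_one hq).mul_const x)
    rw [zero_mul, h0] at hlim
    obtain ⟨N, hN⟩ := (hlim.eventually_ne one_ne_zero).exists
    have h := hiter N
    rw [hx, eq_comm, mul_eq_zero, or_iff_left hN, Finset.prod_eq_zero_iff] at h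
    obtain ⟨k, -, hk⟩ := h
    exact ⟨k, (sub_eq_zero.1 hk).symm⟩
  · rintro ⟨n, hn⟩
    rw [hiter (n + 1), Finset.prod_range_succ, hn]
    simp

/-- The lattice spanned by `ω₁` and `ω₂`. -/
def latticeSpan (ω₁ ω₂ : ℂ) : Set ℂ := {z : ℂ | ∃ m n : ℤ, z = (m : ℂ) * ω₁ + (n : ℂ) * ω₂}

/-- A theta function with simple zeros exactly at the points of the lattice. -/
structure IsTheta (ω₁ ω₂ κ : ℂ) (T : ℂ → ℂ) : Prop where
  differentiable : Differentiable ℂ T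
  mul_period : κ * ω₁ = 2 * Real.pi * Complex.I
  add_left : ∀ z, T (z + ω₁) = T z
  add_right : ∀ z, T (z + ω₂) = Complex.exp (Real.pi * Complex.I - κ * z) * T z
  eq_zero_iff : ∀ z, T z = 0 ↔ z ∈ latticeSpan ω₁ ω₂
  deriv_ne_zero : deriv T 0 ≠ 0

lemma exists_isTheta {ω₁ ω₂ : ℂ} (h : 0 < (ω₂ / ω₁).im) :
    ∃ κ T, IsTheta ω₁ ω₂ κ T := by
  have hω₁ : ω₁ ≠ 0 := by rintro rfl; simp at h
  have hI : (2 * Real.pi * Complex.I : ℂ) ≠ 0 := by simp [Real.pi_ne_zero]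
  set κ : ℂ := 2 * Real.pi * Complex.I / ω₁ with hκ
  have hκ₁ : κ * ω₁ = 2 * Real.pi * Complex.I := by rw [hκ]; field_simp
  have hκ0 : κ ≠ 0 := by rw [hκ]; exact div_ne_zero hI hω₁
  set q : ℂ := Complex.exp (κ * ω₂) with hqdef
  have hq : ‖q‖ < 1 := by
    rw [hqdef, Complex.norm_exp, Real.exp_lt_one_iff,
      show κ * ω₂ = 2 * Real.pi * Complex.I * (ω₂ / ω₁) by rw [hκ]; field_simp]
    simp only [Complex.mul_re, Complex.mul_im, Complex.I_re, Complex.I_im, Complex.ofReal_re,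
      Complex.ofReal_im, Complex.re_ofNat, Complex.im_ofNat]
    nlinarith [Real.pi_pos, mul_pos Real.pi_pos h]
  have hq0 : q ≠ 0 := Complex.exp_ne_zero _
  obtain ⟨ψ, hψ, hψ0, hfe⟩ := exists_qProduct hq
  have hzero := qProduct_eq_zero_iff hq hψ.continuous hψ0 hfe
  have hexp : ∀ z, Complex.exp (κ * z) = 1 ↔ ∃ m : ℤ, z = m * ω₁ := fun z => by
    rw [Complex.exp_eq_one_iff]
    refine exists_congr fun m => ?_
    rw [← hκ₁, mul_left_comm]
    exact mul_right_inj' hκ0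
  have hqexp : ∀ (n : ℤ) (z : ℂ), q ^ n * Complex.exp (κ * z) = Complex.exp (κ * (z + n * ω₂)) :=
    fun n z => by
      rw [hqdef, ← Complex.exp_int_mul, ← Complex.exp_add]; congr 1; ring
  refine ⟨κ, fun z => ψ (Complex.exp (κ * z)) * ψ (q * Complex.exp (-(κ * z))),
    by fun_prop, hκ₁, fun z => ?_, fun z => ?_, fun z => ?_, ?_⟩
  · have h1 : Complex.exp (κ * (z + ω₁)) = Complex.exp (κ * z) := by
      rw [mul_add, hκ₁, Complex.exp_periodic]
    simp only [Complex.exp_neg, h1]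
  · have h1 : Complex.exp (κ * (z + ω₂)) = q * Complex.exp (κ * z) := by
      rw [mul_add, Complex.exp_add, mul_comm]
    have h2 : q * Complex.exp (-(κ * (z + ω₂))) = Complex.exp (-(κ * z)) := by
      rw [Complex.exp_neg, h1, Complex.exp_neg]
      have := Complex.exp_ne_zero (κ * z)
      field_simp
    simp only [h1, h2]
    rw [hfe (Complex.exp (κ * z)), hfe (Complex.exp (-(κ * z))), Complex.exp_sub,
      Complex.exp_pi_mul_I, Complex.exp_neg]
    have := Complex.exp_ne_zero (κ * z)
    field_simp
    ring
  · rw [mul_eq_zero, hzero, hzero]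
    constructor
    · rintro (⟨n, hn⟩ | ⟨n, hn⟩)
      · have := hqexp n z
        rw [zpow_natCast, hn, eq_comm, hexp] at this
        obtain ⟨m, hm⟩ := this
        exact ⟨m, -n, by push_cast; linear_combination hm⟩
      · have := hqexp (n + 1) (-z)
        rw [mul_neg, zpow_add₀ hq0, zpow_one, zpow_natCast, mul_assoc, hn, eq_comm,
          hexp] at this
        obtain ⟨m, hm⟩ := this
        exact ⟨-m, n + 1, by push_cast at hm ⊢; linear_combination -hm⟩
    · rintro ⟨m, n, rfl⟩
      obtain ⟨k, rfl | rfl⟩ : ∃ k : ℕ, n = -k ∨ n = k + 1 := by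
        rcases le_or_gt n 0 with hn | hn
        · exact ⟨n.natAbs, by omega⟩
        · exact ⟨(n - 1).natAbs, by omega⟩
      · refine Or.inl ⟨k, ?_⟩
        rw [← zpow_natCast, hqexp, hexp]
        exact ⟨m, by push_cast; ring⟩
      · refine Or.inr ⟨k, ?_⟩
        rw [← mul_assoc, ← pow_succ, ← zpow_natCast, ← mul_neg, hqexp, hexp]
        exact ⟨-m, by push_cast; ring⟩
  · have hψq : ψ q ≠ 0 := by
      rw [Ne, hzero]
      rintro ⟨n, hn⟩
      rw [← pow_succ] at hn
      have h1 := congrArg norm hn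
      rw [norm_pow, norm_one] at h1
      exact (pow_lt_one₀ (norm_nonneg q) hq n.succ_ne_zero).ne h1
    have hform : (fun z => ψ (Complex.exp (κ * z)) * ψ (q * Complex.exp (-(κ * z)))) =
        fun z => (1 - Complex.exp (κ * z)) *
          (ψ (q * Complex.exp (κ * z)) * ψ (q * Complex.exp (-(κ * z)))) := by
      funext z
      rw [hfe (Complex.exp (κ * z)), mul_assoc]
    have hd1 : HasDerivAt (fun z => 1 - Complex.exp (κ * z)) (-κ) 0 := by
      simpa using (((hasDerivAt_id (0 : ℂ)).const_mul κ).cexp.const_sub 1)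
    have hd2 : DifferentiableAt ℂ
        (fun z => ψ (q * Complex.exp (κ * z)) * ψ (q * Complex.exp (-(κ * z)))) 0 := by
      fun_prop
    rw [hform, (hd1.fun_mul hd2.hasDerivAt).deriv]
    simp [hκ0, hψq]

/-! ### Periodicity -/

lemma latticeSpan_zero_mem (ω₁ ω₂ : ℂ) : (0 : ℂ) ∈ latticeSpan ω₁ ω₂ := ⟨0, 0, by simp⟩

lemma latticeSpan_left_mem (ω₁ ω₂ : ℂ) : ω₁ ∈ latticeSpan ω₁ ω₂ := ⟨1, 0, by simp⟩

lemma latticeSpan_right_mem (ω₁ ω₂ : ℂ) : ω₂ ∈ latticeSpan ω₁ ω₂ := ⟨0, 1, by simp⟩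

lemma latticeSpan_add_mem {ω₁ ω₂ a b : ℂ} (ha : a ∈ latticeSpan ω₁ ω₂)
    (hb : b ∈ latticeSpan ω₁ ω₂) : a + b ∈ latticeSpan ω₁ ω₂ := by
  obtain ⟨m, n, rfl⟩ := ha
  obtain ⟨m', n', rfl⟩ := hb
  exact ⟨m + m', n + n', by push_cast; ring⟩

lemma latticeSpan_neg_mem {ω₁ ω₂ a : ℂ} (ha : a ∈ latticeSpan ω₁ ω₂) :
    -a ∈ latticeSpan ω₁ ω₂ := by
  obtain ⟨m, n, rfl⟩ := ha
  exact ⟨-m, -n, by push_cast; ring⟩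

lemma latticeSpan_sub_mem {ω₁ ω₂ a b : ℂ} (ha : a ∈ latticeSpan ω₁ ω₂)
    (hb : b ∈ latticeSpan ω₁ ω₂) : a - b ∈ latticeSpan ω₁ ω₂ :=
  sub_eq_add_neg a b ▸ latticeSpan_add_mem ha (latticeSpan_neg_mem hb)

lemma eq_add_of_mem_latticeSpan {β : Type*} {ω₁ ω₂ : ℂ} {f : ℂ → β}
    (h₁ : ∀ z, f (z + ω₁) = f z) (h₂ : ∀ z, f (z + ω₂) = f z) {l : ℂ}
    (hl : l ∈ latticeSpan ω₁ ω₂) (z : ℂ) : f (z + l) = f z := by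
  obtain ⟨m, n, rfl⟩ := hl
  rw [← add_assoc, Function.Periodic.int_mul h₂ n, Function.Periodic.int_mul h₁ m]

/-- A compact set meets every coset of a lattice. -/
lemma exists_isCompact_add_mem {ω₁ ω₂ : ℂ} (h : 0 < (ω₂ / ω₁).im) :
    ∃ K : Set ℂ, IsCompact K ∧ ∀ z, ∃ l ∈ latticeSpan ω₁ ω₂, z + l ∈ K := by
  have hω₁ : ω₁ ≠ 0 := by rintro rfl; simp at h
  refine ⟨(fun p : ℝ × ℝ => (p.1 : ℂ) * ω₁ + (p.2 : ℂ) * ω₂) '' (Icc 0 1 ×ˢ Icc 0 1),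
    (isCompact_Icc.prod isCompact_Icc).image (by fun_prop), fun z => ?_⟩
  set t := ω₂ / ω₁ with ht
  set y : ℝ := (z / ω₁).im / t.im with hy
  set x : ℝ := (z / ω₁).re - y * t.re with hx
  have hz : z = x * ω₁ + y * ω₂ := by
    have h1 : z / ω₁ = x + y * t := by
      apply Complex.ext
      · simp [hx]
      · simp [hy, h.ne']
    rw [ht] at h1
    field_simp at h1
    linear_combination h1
  refine ⟨_, ⟨-⌊x⌋, -⌊y⌋, rfl⟩, ⟨(Int.fract x, Int.fract y),
    ⟨⟨Int.fract_nonneg x, (Int.fract_lt_one x).le⟩,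
      ⟨Int.fract_nonneg y, (Int.fract_lt_one y).le⟩⟩, ?_⟩⟩
  have hfx : ((Int.fract x : ℝ) : ℂ) = x - ⌊x⌋ := by rw [Int.fract]; push_cast; rfl
  have hfy : ((Int.fract y : ℝ) : ℂ) = y - ⌊y⌋ := by rw [Int.fract]; push_cast; rfl
  simp only [hfx, hfy]
  push_cast
  linear_combination -hz

lemma eq_of_differentiable_of_periodic {ω₁ ω₂ : ℂ} (h : 0 < (ω₂ / ω₁).im) {H : ℂ → ℂ}
    (hH : Differentiable ℂ H) (h₁ : ∀ z, H (z + ω₁) = H z) (h₂ : ∀ z, H (z + ω₂) = H z)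
    (z w : ℂ) : H z = H w := by
  obtain ⟨K, hK, hKL⟩ := exists_isCompact_add_mem h
  obtain ⟨C, hC⟩ := hK.exists_bound_of_continuousOn hH.continuous.continuousOn
  refine hH.apply_eq_apply_of_bounded (isBounded_iff_forall_norm_le.2 ⟨C, ?_⟩) z w
  rintro _ ⟨x, rfl⟩
  obtain ⟨l, hl, hxl⟩ := hKL x
  rw [← eq_add_of_mem_latticeSpan h₁ h₂ hl]
  exact hC _ hxl

/-- An entire function that is periodic up to an additive constant is constant. -/
lemma eq_const_of_differentiable_of_quasiPeriodic {ω₁ ω₂ κ : ℂ} (h : 0 < (ω₂ / ω₁).im)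
    {H : ℂ → ℂ} (hH : Differentiable ℂ H) (h₁ : ∀ z, H (z + ω₁) = H z)
    (h₂ : ∀ z, H (z + ω₂) = H z + κ) : κ = 0 ∧ ∃ c, ∀ z, H z = c := by
  have hω₁ : ω₁ ≠ 0 := by rintro rfl; simp at h
  have hd₁ : ∀ z, deriv H (z + ω₁) = deriv H z := fun z => by
    rw [← deriv_comp_add_const]
    simp only [h₁]
  have hd₂ : ∀ z, deriv H (z + ω₂) = deriv H z := fun z => by
    rw [← deriv_comp_add_const]
    simp only [h₂, deriv_add_const]
  set a := deriv H 0 with ha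
  have hda : ∀ z, deriv H z = a := fun z =>
    eq_of_differentiable_of_periodic h (hH.deriv) hd₁ hd₂ z 0
  have hlin : ∀ z w, H z - a * z = H w - a * w := by
    refine is_const_of_deriv_eq_zero (by fun_prop) fun z => ?_
    rw [deriv_fun_sub hH.differentiableAt (by fun_prop), hda]
    simp
  have ha0 : a = 0 := by
    have h0 := hlin (0 + ω₁) 0
    rw [h₁] at h0
    have : a * ω₁ = 0 := by linear_combination -h0
    exact (mul_eq_zero.1 this).resolve_right hω₁
  simp only [ha0, zero_mul, sub_zero] at hlin
  refine ⟨?_, H 0, fun z => hlin z 0⟩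
  have h0 := h₂ 0
  rw [hlin (0 + ω₂) 0] at h0
  linear_combination -h0

/-! ### Simple poles with integral residue -/

/-- `g` has at most a simple pole at `α`, with residue the integer `n`. -/
def HasIntResidueAt (g : ℂ → ℂ) (α : ℂ) (n : ℤ) : Prop :=
  ExtAnalyticAt (fun z => g z - n / (z - α)) α

lemma eventually_nhdsNE_add {p : ℂ → Prop} {α : ℂ} (c : ℂ) :
    (∀ᶠ z in 𝓝[≠] (α + c), p z) ↔ ∀ᶠ z in 𝓝[≠] α, p (z + c) := by
  have h : map (· + c) (𝓝[≠] α) = 𝓝[≠] (α + c) := by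
    rw [← Homeomorph.coe_addRight, (Homeomorph.addRight c).isEmbedding.map_nhdsWithin_eq,
      (Homeomorph.addRight c).image_compl]
    simp [nhdsWithin]
  rw [← h, eventually_map]

lemma eventually_nhdsNE_eventually_nhds {p : ℂ → Prop} {α : ℂ} (h : ∀ᶠ z in 𝓝[≠] α, p z) :
    ∀ᶠ z in 𝓝[≠] α, ∀ᶠ w in 𝓝 z, p w := by
  filter_upwards [eventually_eventually_nhdsWithin.2 h, self_mem_nhdsWithin] with z hz hzα
  rwa [isOpen_compl_singleton.nhdsWithin_eq hzα] at hz

lemma extAnalyticAt_congr {F G : ℂ → ℂ} {α : ℂ} (h : ∀ᶠ z in 𝓝[≠] α, F z = G z) :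
    ExtAnalyticAt F α ↔ ExtAnalyticAt G α := by
  constructor
  · rintro ⟨u, hu, hF⟩
    exact ⟨u, hu, by filter_upwards [h, hF] with z h1 h2 using h1 ▸ h2⟩
  · rintro ⟨u, hu, hF⟩
    exact ⟨u, hu, by filter_upwards [h, hF] with z h1 h2 using h1 ▸ h2⟩

lemma hasIntResidueAt_congr {F G : ℂ → ℂ} {α : ℂ} {n : ℤ} (h : ∀ᶠ z in 𝓝[≠] α, F z = G z) :
    HasIntResidueAt F α n ↔ HasIntResidueAt G α n :=
  extAnalyticAt_congr (h.mono fun z hz => by simp only [hz])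

lemma ExtAnalyticAt.hasIntResidueAt {F : ℂ → ℂ} {α : ℂ} (h : ExtAnalyticAt F α) :
    HasIntResidueAt F α 0 := by
  simpa [HasIntResidueAt] using h

lemma HasIntResidueAt.extAnalyticAt {F : ℂ → ℂ} {α : ℂ} (h : HasIntResidueAt F α 0) :
    ExtAnalyticAt F α := by
  simpa [HasIntResidueAt] using h

lemma AnalyticAt.hasIntResidueAt {F : ℂ → ℂ} {α : ℂ} (h : AnalyticAt ℂ F α) :
    HasIntResidueAt F α 0 :=
  ExtAnalyticAt.hasIntResidueAt ⟨F, h, Eventually.of_forall fun _ => rfl⟩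

lemma HasIntResidueAt.add {F G : ℂ → ℂ} {α : ℂ} {m n : ℤ} (hF : HasIntResidueAt F α m)
    (hG : HasIntResidueAt G α n) : HasIntResidueAt (fun z => F z + G z) α (m + n) := by
  obtain ⟨u, hu, hFu⟩ := hF
  obtain ⟨v, hv, hGv⟩ := hG
  refine ⟨u + v, hu.add hv, ?_⟩
  filter_upwards [hFu, hGv] with z h1 h2
  rw [Pi.add_apply, ← h1, ← h2]
  push_cast
  ring

lemma HasIntResidueAt.int_mul {F : ℂ → ℂ} {α : ℂ} {n : ℤ} (hF : HasIntResidueAt F α n) (k : ℤ) :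
    HasIntResidueAt (fun z => k * F z) α (k * n) := by
  obtain ⟨u, hu, hFu⟩ := hF
  refine ⟨fun z => k * u z, analyticAt_const.mul hu, ?_⟩
  filter_upwards [hFu] with z h1
  rw [← h1]
  push_cast
  ring

lemma HasIntResidueAt.sub {F G : ℂ → ℂ} {α : ℂ} {m n : ℤ} (hF : HasIntResidueAt F α m)
    (hG : HasIntResidueAt G α n) : HasIntResidueAt (fun z => F z - G z) α (m - n) := by
  simpa [sub_eq_add_neg] using hF.add (hG.int_mul (-1))

lemma HasIntResidueAt.sum {ι : Type*} (A : Finset ι) {F : ι → ℂ → ℂ} {α : ℂ} {n : ι → ℤ}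
    (hF : ∀ i ∈ A, HasIntResidueAt (F i) α (n i)) :
    HasIntResidueAt (fun z => ∑ i ∈ A, F i z) α (∑ i ∈ A, n i) := by
  classical
  induction A using Finset.induction_on with
  | empty => simpa using (analyticAt_const (v := (0 : ℂ)) (x := α)).hasIntResidueAt
  | insert a A ha ih =>
    simp only [Finset.sum_insert ha]
    exact (hF a (by simp)).add (ih fun i hi => hF i (by simp [hi]))

lemma hasIntResidueAt_comp_add {F : ℂ → ℂ} {α : ℂ} {n : ℤ} (c : ℂ) :
    HasIntResidueAt (fun z => F (z + c)) α n ↔ HasIntResidueAt F (α + c) n := by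
  constructor
  · rintro ⟨u, hu, h⟩
    refine ⟨fun z => u (z - c), ?_, ?_⟩
    · exact AnalyticAt.fun_comp (by simpa using hu) (by fun_prop)
    · rw [eventually_nhdsNE_add]
      simpa using h
  · rintro ⟨u, hu, h⟩
    rw [eventually_nhdsNE_add] at h
    exact ⟨fun z => u (z + c), AnalyticAt.fun_comp hu (by fun_prop), by simpa using h⟩

lemma HasIntResidueAt.unique {F : ℂ → ℂ} {α : ℂ} {m n : ℤ} (hm : HasIntResidueAt F α m)
    (hn : HasIntResidueAt F α n) : m = n := by
  obtain ⟨u, hu, hFu⟩ := hm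
  obtain ⟨v, hv, hFv⟩ := hn
  have h : ∀ᶠ z in 𝓝[≠] α, (z - α) * (v z - u z) = m - n := by
    filter_upwards [hFu, hFv, self_mem_nhdsWithin] with z h1 h2 hz
    have hz' : z - α ≠ 0 := sub_ne_zero.2 hz
    rw [← h1, ← h2]
    field_simp
    ring
  have hlim : Tendsto (fun z => (z - α) * (v z - u z)) (𝓝[≠] α) (𝓝 ((α - α) * (v α - u α))) :=
    (((continuous_id.sub continuous_const).continuousAt).mul
      (hv.continuousAt.sub hu.continuousAt)).tendsto.mono_left nhdsWithin_le_nhds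
  have := tendsto_nhds_unique hlim ((tendsto_congr' h).2 tendsto_const_nhds)
  rw [sub_self, zero_mul, eq_comm, sub_eq_zero] at this
  exact_mod_cast this

lemma HasOrderAt.hasIntResidueAt_logDeriv {f : ℂ → ℂ} {α : ℂ} {d : ℤ} (h : HasOrderAt f α d) :
    HasIntResidueAt (logDeriv f) α d := by
  obtain ⟨g, hg, hg0, hfg⟩ := h
  refine ⟨logDeriv g, by exact hg.deriv.div hg hg0, ?_⟩
  filter_upwards [eventually_nhdsNE_eventually_nhds hfg, self_mem_nhdsWithin,
    (hg.eventually_analyticAt).filter_mono nhdsWithin_le_nhds,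
    (hg.continuousAt.eventually_ne hg0).filter_mono nhdsWithin_le_nhds] with z h1 hz h2 h3
  have hz' : z - α ≠ 0 := sub_ne_zero.2 hz
  have hdz : DifferentiableAt ℂ (fun w => (w - α) ^ d) z :=
    (differentiableAt_id.sub_const α).zpow (Or.inl hz')
  rw [(logDeriv_congr_nhds (f := f) h1).eq_of_nhds,
    logDeriv_mul (f := fun w => (w - α) ^ d) z (zpow_ne_zero d hz') h3 hdz
    h2.differentiableAt, logDeriv_fun_zpow (by fun_prop)]
  simp [logDeriv_apply, div_eq_mul_inv]

lemma HasIntResidueAt.eventually_eq_zero {g : ℂ → ℂ} {ρ : ℂ → ℤ}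
    (hg : ∀ α, HasIntResidueAt g α (ρ α)) (α : ℂ) : ∀ᶠ z in 𝓝[≠] α, ρ z = 0 := by
  obtain ⟨u, hu, hgu⟩ := hg α
  filter_upwards [eventually_nhdsNE_eventually_nhds hgu, self_mem_nhdsWithin,
    hu.eventually_analyticAt.filter_mono nhdsWithin_le_nhds] with z h1 hz h2
  refine (hg z).unique (AnalyticAt.hasIntResidueAt ?_)
  have hz' : z - α ≠ 0 := sub_ne_zero.2 hz
  refine (h2.add (analyticAt_const.div (analyticAt_id.sub analyticAt_const) hz') :
    AnalyticAt ℂ (u + fun w => (ρ α : ℂ) / (w - α)) z).congr ?_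
  filter_upwards [h1] with w hw
  simp [← hw]

/-! ### The logarithmic derivative of the theta function -/

namespace IsTheta

variable {ω₁ ω₂ κ : ℂ} {T : ℂ → ℂ}

lemma logDeriv_add_left (hT : IsTheta ω₁ ω₂ κ T) (z : ℂ) :
    logDeriv T (z + ω₁) = logDeriv T z := by
  rw [logDeriv_apply, logDeriv_apply, ← deriv_comp_add_const]
  simp only [hT.add_left]

lemma logDeriv_add_right (hT : IsTheta ω₁ ω₂ κ T) {z : ℂ} (hz : T z ≠ 0) :
    logDeriv T (z + ω₂) = logDeriv T z - κ := by
  have h1 : logDeriv T (z + ω₂) = logDeriv (fun w => T (w + ω₂)) z := by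
    rw [logDeriv_apply, logDeriv_apply, deriv_comp_add_const]
  have h2 : HasDerivAt (fun w => Complex.exp (Real.pi * Complex.I - κ * w))
      (Complex.exp (Real.pi * Complex.I - κ * z) * -κ) z := by
    simpa only [id, mul_one] using
      (((hasDerivAt_id z).const_mul κ).const_sub (Real.pi * Complex.I)).cexp
  rw [h1, funext hT.add_right,
    logDeriv_mul (f := fun w => Complex.exp (Real.pi * Complex.I - κ * w)) z
    (Complex.exp_ne_zero _) hz h2.differentiableAt hT.differentiable.differentiableAt,
    logDeriv_apply, h2.deriv, mul_div_cancel_left₀ _ (Complex.exp_ne_zero _)]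
  ring

lemma eventually_ne_zero (hT : IsTheta ω₁ ω₂ κ T) (α : ℂ) : ∀ᶠ z in 𝓝[≠] α, T z ≠ 0 := by
  by_contra h
  have hTa : AnalyticOnNhd ℂ T univ := fun z _ => hT.differentiable.analyticAt z
  have h0 := hTa.eqOn_zero_of_preconnected_of_frequently_eq_zero isPreconnected_univ
    (mem_univ α) (by simpa only [Filter.Frequently, ne_eq] using h)
  apply hT.deriv_ne_zero
  rw [show T = fun _ => 0 from funext fun z => h0 (mem_univ z), deriv_const]

lemma eventually_forall_sub_ne_zero (hT : IsTheta ω₁ ω₂ κ T) {ι : Type*} (A : Finset ι)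
    (a : ι → ℂ) (α : ℂ) : ∀ᶠ z in 𝓝[≠] α, ∀ i ∈ A, T (z - a i) ≠ 0 := by
  rw [Filter.eventually_all_finset]
  intro i _
  have := hT.eventually_ne_zero (α + -a i)
  rw [eventually_nhdsNE_add] at this
  simpa only [← sub_eq_add_neg] using this

lemma hasIntResidueAt_logDeriv_of_mem (hT : IsTheta ω₁ ω₂ κ T) {l : ℂ}
    (hl : l ∈ latticeSpan ω₁ ω₂) : HasIntResidueAt (logDeriv T) l 1 := by
  have h0 : HasIntResidueAt (logDeriv T) 0 1 := by
    have hT0 : T 0 = 0 := (hT.eq_zero_iff 0).2 (latticeSpan_zero_mem _ _)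
    refine HasOrderAt.hasIntResidueAt_logDeriv ⟨dslope T 0, ?_, ?_, ?_⟩
    · exact ((Complex.differentiableOn_dslope univ_mem).2
        hT.differentiable.differentiableOn).analyticAt univ_mem
    · rw [dslope_same]
      exact hT.deriv_ne_zero
    · refine Eventually.of_forall fun z => ?_
      have := sub_smul_dslope T 0 z
      rw [hT0, sub_zero (T z)] at this
      rw [← this, zpow_one, smul_eq_mul]
  have h₁ : ∀ z, HasIntResidueAt (logDeriv T) (z + ω₁) 1 = HasIntResidueAt (logDeriv T) z 1 :=
    fun z => by
      rw [← hasIntResidueAt_comp_add]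
      simp only [hT.logDeriv_add_left]
  have h₂ : ∀ z, HasIntResidueAt (logDeriv T) (z + ω₂) 1 = HasIntResidueAt (logDeriv T) z 1 :=
    fun z => by
      have hκ : ∀ c : ℂ, HasIntResidueAt (fun _ => c) z 0 := fun c =>
        analyticAt_const.hasIntResidueAt
      rw [← hasIntResidueAt_comp_add, hasIntResidueAt_congr
        ((hT.eventually_ne_zero z).mono fun w hw => hT.logDeriv_add_right hw)]
      exact propext ⟨fun h => by simpa using h.add (hκ κ), fun h => by simpa using h.sub (hκ κ)⟩
  have := eq_add_of_mem_latticeSpan (f := fun z => HasIntResidueAt (logDeriv T) z 1)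
    h₁ h₂ hl 0
  simp only [zero_add] at this
  rwa [this]

open Classical in
lemma hasIntResidueAt_logDeriv (hT : IsTheta ω₁ ω₂ κ T) (z : ℂ) :
    HasIntResidueAt (logDeriv T) z (if z ∈ latticeSpan ω₁ ω₂ then 1 else 0) := by
  split_ifs with hz
  · exact hT.hasIntResidueAt_logDeriv_of_mem hz
  · rw [← hT.eq_zero_iff] at hz
    have hTz := hT.differentiable.analyticAt z
    exact AnalyticAt.hasIntResidueAt (by exact hTz.deriv.div hTz hz)

end IsTheta

/-! ### Elliptic functions with simple poles and integral residues -/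

lemma ContinuousAt.eq_of_eventuallyEq_nhdsNE {F G : ℂ → ℂ} {α : ℂ} (hF : ContinuousAt F α)
    (hG : ContinuousAt G α) (h : ∀ᶠ z in 𝓝[≠] α, F z = G z) : F α = G α :=
  ((hF.eventuallyEq_nhds_iff_eventuallyEq_nhdsNE hG).1 h).eq_of_nhds

lemma exists_differentiable_of_extAnalyticAt {F : ℂ → ℂ} (hF : ∀ α, ExtAnalyticAt F α) :
    ∃ H : ℂ → ℂ, Differentiable ℂ H ∧ ∀ α, ∀ᶠ z in 𝓝[≠] α, F z = H z := by
  choose u hu hFu using hF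
  have key : ∀ α, ∀ᶠ z in 𝓝 α, u z z = u α z := fun α => by
    rw [← nhdsNE_sup_pure, eventually_sup]
    refine ⟨?_, by simp⟩
    filter_upwards [eventually_nhdsNE_eventually_nhds (hFu α),
      (hu α).eventually_analyticAt.filter_mono nhdsWithin_le_nhds] with z h1 h2
    refine (hu z).continuousAt.eq_of_eventuallyEq_nhdsNE h2.continuousAt ?_
    filter_upwards [hFu z, h1.filter_mono nhdsWithin_le_nhds] with w h3 h4
    rw [← h3, h4]
  refine ⟨fun z => u z z, fun α => ?_, fun α => ?_⟩
  · exact ((hu α).congr (by filter_upwards [key α] with z hz using hz.symm)).differentiableAt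
  · filter_upwards [hFu α, (key α).filter_mono nhdsWithin_le_nhds] with z h1 h2
    rw [h1, h2]

lemma HasIntResidueAt.add_mem_eq {ω₁ ω₂ : ℂ} {g : ℂ → ℂ} {ρ : ℂ → ℤ}
    (hρ : ∀ α, HasIntResidueAt g α (ρ α))
    (hg : ∀ l ∈ latticeSpan ω₁ ω₂, ∀ α, ∀ᶠ z in 𝓝[≠] α, g (z + l) = g z) {l : ℂ}
    (hl : l ∈ latticeSpan ω₁ ω₂) (α : ℂ) : ρ (α + l) = ρ α := by
  have h := hρ (α + l)
  rw [← hasIntResidueAt_comp_add, hasIntResidueAt_congr (hg l hl α)] at h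
  exact h.unique (hρ α)

/-- An elliptic function with simple poles and integral residues has residue sum zero, and is a
linear combination of translates of the logarithmic derivative of the theta function. -/
lemma IsTheta.residue_sum_eq_zero_and_expansion {ω₁ ω₂ κ : ℂ} {T : ℂ → ℂ}
    (h : 0 < (ω₂ / ω₁).im) (hT : IsTheta ω₁ ω₂ κ T) {g : ℂ → ℂ} {ρ : ℂ → ℤ}
    (hρ : ∀ α, HasIntResidueAt g α (ρ α))
    (hg : ∀ l ∈ latticeSpan ω₁ ω₂, ∀ α, ∀ᶠ z in 𝓝[≠] α, g (z + l) = g z)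
    {ι : Type*} (A : Finset ι) (a : ι → ℂ)
    (hinj : ∀ i ∈ A, ∀ j ∈ A, a i - a j ∈ latticeSpan ω₁ ω₂ → i = j)
    (hsupp : ∀ z, ρ z ≠ 0 → ∃ i ∈ A, z - a i ∈ latticeSpan ω₁ ω₂) :
    ∑ i ∈ A, ρ (a i) = 0 ∧ ∃ c, ∀ α, ∀ᶠ z in 𝓝[≠] α,
      g z = c + ∑ i ∈ A, ρ (a i) * logDeriv T (z - a i) := by
  classical
  have hZ : ∀ i α, HasIntResidueAt (fun z => logDeriv T (z - a i)) α
      (if α - a i ∈ latticeSpan ω₁ ω₂ then 1 else 0) := fun i α => by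
    have := hT.hasIntResidueAt_logDeriv (α + -a i)
    rw [← hasIntResidueAt_comp_add] at this
    simpa only [← sub_eq_add_neg] using this
  have hsum : ∀ α, ∑ i ∈ A, ρ (a i) * (if α - a i ∈ latticeSpan ω₁ ω₂ then 1 else 0) = ρ α := by
    intro α
    have hα : ∀ i, α - a i ∈ latticeSpan ω₁ ω₂ → ρ α = ρ (a i) := fun i hi => by
      simpa using HasIntResidueAt.add_mem_eq hρ hg hi (a i)
    by_cases hex : ∃ i ∈ A, α - a i ∈ latticeSpan ω₁ ω₂
    · obtain ⟨i, hi, hli⟩ := hex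
      rw [Finset.sum_eq_single_of_mem i hi, if_pos hli, mul_one, hα i hli]
      intro j hj hji
      rw [if_neg, mul_zero]
      intro hlj
      refine hji (hinj j hj i hi ?_)
      simpa using latticeSpan_sub_mem hli hlj
    · have h0 : ρ α = 0 := by
        by_contra h0
        exact hex (hsupp α h0)
      rw [h0]
      refine Finset.sum_eq_zero fun i hi => ?_
      rw [if_neg fun hli => hex ⟨i, hi, hli⟩, mul_zero]
  have hext : ∀ α, ExtAnalyticAt
      (fun z => g z - ∑ i ∈ A, ρ (a i) * logDeriv T (z - a i)) α := fun α => by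
    have := (hρ α).sub (HasIntResidueAt.sum A fun i _ => (hZ i α).int_mul (ρ (a i)))
    rw [hsum, sub_self] at this
    exact this.extAnalyticAt
  obtain ⟨H, hH, hFH⟩ := exists_differentiable_of_extAnalyticAt hext
  have hHc := hH.continuous
  have hH₁ : ∀ z, H (z + ω₁) = H z := fun z => by
    refine ContinuousAt.eq_of_eventuallyEq_nhdsNE (F := fun z => H (z + ω₁))
      (by fun_prop) hHc.continuousAt ?_
    filter_upwards [hFH z, (eventually_nhdsNE_add ω₁).1 (hFH (z + ω₁)),
      hg ω₁ (latticeSpan_left_mem _ _) z] with w h1 h2 h3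
    rw [← h1, ← h2, h3]
    congr 1
    refine Finset.sum_congr rfl fun i _ => ?_
    rw [add_sub_right_comm, hT.logDeriv_add_left]
  have hH₂ : ∀ z, H (z + ω₂) = H z + (∑ i ∈ A, ρ (a i) : ℤ) * κ := fun z => by
    refine ContinuousAt.eq_of_eventuallyEq_nhdsNE (F := fun z => H (z + ω₂))
      (G := fun z => H z + (∑ i ∈ A, ρ (a i) : ℤ) * κ) (by fun_prop) (by fun_prop) ?_
    filter_upwards [hFH z, (eventually_nhdsNE_add ω₂).1 (hFH (z + ω₂)),
      hg ω₂ (latticeSpan_right_mem _ _) z,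
      hT.eventually_forall_sub_ne_zero A a z] with w h1 h2 h3 h4
    have h5 : ∑ i ∈ A, (ρ (a i) : ℂ) * logDeriv T (w + ω₂ - a i) =
        ∑ i ∈ A, ((ρ (a i) : ℂ) * logDeriv T (w - a i) - ρ (a i) * κ) :=
      Finset.sum_congr rfl fun i hi => by
        rw [add_sub_right_comm, hT.logDeriv_add_right (h4 i hi), mul_sub]
    rw [← h1, ← h2, h3, h5, Finset.sum_sub_distrib, ← Finset.sum_mul]
    push_cast
    ring
  obtain ⟨h0, c, hc⟩ := eq_const_of_differentiable_of_quasiPeriodic h hH hH₁ hH₂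
  have hκ : κ ≠ 0 := by
    rintro rfl
    simpa [Real.pi_ne_zero] using hT.mul_period
  refine ⟨by exact_mod_cast (mul_eq_zero.1 h0).resolve_right hκ, c, fun α => ?_⟩
  filter_upwards [hFH α] with z hz
  rw [← hc z, ← hz]
  ring

/-! ### Finite support along a pinning -/

lemma IsPinning.eq_of_sub_mem {ω₁ ω₂ s : ℂ} {R : Set ℂ}
    (hR : IsPinning (latticeSpan ω₁ ω₂) s R) {r r' : ℂ} {n n' : ℤ} (hr : r ∈ R) (hr' : r' ∈ R)
    (h : r + n * s - (r' + n' * s) ∈ latticeSpan ω₁ ω₂) : r = r' ∧ n = n' := by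
  have := (hR (r + n * s)).unique (y₁ := (r, n, 0))
    (y₂ := (r', n', r + n * s - (r' + n' * s)))
    ⟨hr, latticeSpan_zero_mem _ _, by simp⟩ ⟨hr', h, by simp⟩
  simp only [Prod.mk.injEq] at this
  exact ⟨this.1, this.2.1⟩

lemma IsPinning.injOn_finset {ω₁ ω₂ s : ℂ} {R : Set ℂ}
    (hR : IsPinning (latticeSpan ω₁ ω₂) s R) {R₀ : Finset ℂ} {N₀ : Finset ℤ} (hR₀ : ↑R₀ ⊆ R) :
    ∀ p ∈ R₀ ×ˢ N₀, ∀ q ∈ R₀ ×ˢ N₀,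
      p.1 + p.2 * s - (q.1 + q.2 * s) ∈ latticeSpan ω₁ ω₂ → p = q := by
  intro p hp q hq hpq
  obtain ⟨h1, h2⟩ := hR.eq_of_sub_mem (hR₀ (Finset.mem_product.1 hp).1)
    (hR₀ (Finset.mem_product.1 hq).1) hpq
  exact Prod.ext h1 h2

lemma IsPinning.exists_mem_finset {ω₁ ω₂ s : ℂ} {R : Set ℂ}
    (hR : IsPinning (latticeSpan ω₁ ω₂) s R) {ρ : ℂ → ℤ}
    (hρ : ∀ l ∈ latticeSpan ω₁ ω₂, ∀ α, ρ (α + l) = ρ α) {R₀ : Finset ℂ} {N₀ : Finset ℤ}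
    (hN₀ : ∀ r ∈ R, ∀ n : ℤ, ρ (r + n * s) ≠ 0 → r ∈ R₀ ∧ n ∈ N₀) (z : ℂ) (hz : ρ z ≠ 0) :
    ∃ p ∈ R₀ ×ˢ N₀, z - (p.1 + p.2 * s) ∈ latticeSpan ω₁ ω₂ := by
  obtain ⟨⟨r, n, l⟩, ⟨hr, hl, rfl⟩, -⟩ := hR z
  dsimp only at hr hl hz ⊢
  rw [hρ l hl] at hz
  exact ⟨(r, n), Finset.mem_product.2 (hN₀ r hr n hz), by simpa using hl⟩

lemma IsPinning.exists_finset {ω₁ ω₂ s : ℂ} {R : Set ℂ} (h : 0 < (ω₂ / ω₁).im)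
    (hR : IsPinning (latticeSpan ω₁ ω₂) s R) {ρ : ℂ → ℤ}
    (hρ : ∀ l ∈ latticeSpan ω₁ ω₂, ∀ α, ρ (α + l) = ρ α)
    (hρ0 : ∀ α, ∀ᶠ z in 𝓝[≠] α, ρ z = 0) :
    ∃ (R₀ : Finset ℂ) (N₀ : Finset ℤ), ↑R₀ ⊆ R ∧
      ∀ r ∈ R, ∀ n : ℤ, ρ (r + n * s) ≠ 0 → r ∈ R₀ ∧ n ∈ N₀ := by
  classical
  obtain ⟨K, hK, hKL⟩ := exists_isCompact_add_mem h
  have hfin : {z ∈ K | ρ z ≠ 0}.Finite := by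
    by_contra hinf
    obtain ⟨x, -, hx⟩ := Set.Infinite.exists_accPt_of_subset_isCompact hinf hK (sep_subset _ _)
    rw [accPt_iff_frequently_nhdsNE] at hx
    exact hx ((hρ0 x).mono fun z hz hz' => hz'.2 hz)
  choose p hp hpu using hR
  refine ⟨hfin.toFinset.image fun z => (p z).1, hfin.toFinset.image fun z => (p z).2.1, ?_, ?_⟩
  · intro r hr
    simp only [Finset.coe_image, mem_image] at hr
    obtain ⟨z, -, rfl⟩ := hr
    exact (hp z).1
  · intro r hr n hn
    obtain ⟨l, hl, hlK⟩ := hKL (r + n * s)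
    have hpz := hpu (r + n * s + l) (r, n, l) ⟨hr, hl, rfl⟩
    have hmem : r + n * s + l ∈ hfin.toFinset := by
      rw [Set.Finite.mem_toFinset]
      exact ⟨hlK, by rwa [hρ l hl]⟩
    exact ⟨Finset.mem_image.2 ⟨_, hmem, by rw [← hpz]⟩,
      Finset.mem_image.2 ⟨_, hmem, by rw [← hpz]⟩⟩

lemma finsum_eq_sum_of_ne_zero_imp_mem {R : Set ℂ} {R₀ : Finset ℂ} {N₀ : Finset ℤ}
    {c : ℂ → ℤ → ℤ} (h : ∀ r ∈ R, ∀ n, c r n ≠ 0 → r ∈ R₀ ∧ n ∈ N₀) {r : ℂ} (hr : r ∈ R) :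
    ∑ᶠ n, c r n = ∑ n ∈ N₀, c r n :=
  finsum_eq_sum_of_support_subset _ fun n hn => (h r hr n hn).2

lemma finsum_mem_finsum_eq_sum {R : Set ℂ} {R₀ : Finset ℂ} (hR₀ : ↑R₀ ⊆ R) {N₀ : Finset ℤ}
    {c : ℂ → ℤ → ℤ} (h : ∀ r ∈ R, ∀ n, c r n ≠ 0 → r ∈ R₀ ∧ n ∈ N₀) :
    ∑ᶠ r ∈ R, ∑ᶠ n, c r n = ∑ p ∈ R₀ ×ˢ N₀, c p.1 p.2 := by
  rw [finsum_mem_congr rfl fun r hr => finsum_eq_sum_of_ne_zero_imp_mem h hr,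
    finsum_mem_eq_sum_of_inter_support_eq (t := R₀), Finset.sum_product]
  ext r
  refine ⟨fun ⟨hr, hr'⟩ => ⟨?_, hr'⟩, fun ⟨hr, hr'⟩ => ⟨hR₀ hr, hr'⟩⟩
  obtain ⟨n, -, hn⟩ := Finset.exists_ne_zero_of_sum_ne_zero hr'
  exact (h r hr n hn).1

lemma finsum_shift_sub (p : ℤ → ℤ) (hp : p.support.Finite) : ∑ᶠ n, (p (n + 1) - p n) = 0 := by
  have hp' : (Function.support fun n => p (n + 1)).Finite :=
    hp.preimage (Equiv.addRight (1 : ℤ)).injective.injOn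
  rw [finsum_sub_distrib hp' hp, sub_eq_zero]
  exact finsum_comp_equiv (Equiv.addRight (1 : ℤ)) (f := p)

lemma finsum_mul_shift_sub (p : ℤ → ℤ) (hp : p.support.Finite) :
    ∑ᶠ n, n * (p (n + 1) - p n) = -∑ᶠ n, p n := by
  have hp' : (Function.support fun n => p (n + 1)).Finite :=
    hp.preimage (Equiv.addRight (1 : ℤ)).injective.injOn
  have hnp : (Function.support fun n => n * p n).Finite :=
    hp.subset fun n hn => right_ne_zero_of_mul hn
  have hq : ∀ n, n * (p (n + 1) - p n) = ((n + 1) * p (n + 1) - n * p n) - p (n + 1) :=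
    fun n => by ring
  have hs := finsum_shift_sub _ hnp
  have hfin : (Function.support fun n => (n + 1) * p (n + 1) - n * p n).Finite :=
    (hp'.union hp).subset fun n hn => by
      by_contra hcon
      simp only [mem_union, Function.mem_support, not_or, not_not] at hcon
      simp [hcon.1, hcon.2] at hn
  simp_rw [hq]
  rw [finsum_sub_distrib hfin hp', hs, zero_sub, neg_inj]
  exact finsum_comp_equiv (Equiv.addRight (1 : ℤ)) (f := p)

/-! ### Necessity -/

lemma IsElliptic.eventually_add_eq {L : Set ℂ} {g : ℂ → ℂ} (hg : IsElliptic L g) {l : ℂ}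
    (hl : l ∈ L) (α : ℂ) : ∀ᶠ z in 𝓝[≠] α, g (z + l) = g z :=
  (hg.1 α (mem_univ α)).eventually_analyticAt.mono fun z hz => hg.2 l hl z hz

lemma IsElliptic.eventually_logDeriv_add_eq {L : Set ℂ} {f : ℂ → ℂ} (hf : IsElliptic L f) {l : ℂ}
    (hl : l ∈ L) (α : ℂ) : ∀ᶠ z in 𝓝[≠] α, logDeriv f (z + l) = logDeriv f z := by
  filter_upwards [eventually_nhdsNE_eventually_nhds (hf.eventually_add_eq hl α)] with z hz
  rw [logDeriv_apply, logDeriv_apply, ← deriv_comp_add_const,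
    EventuallyEq.deriv_eq (f := f) hz, hz.self_of_nhds]

lemma exists_hasIntResidueAt_of_sub_eq {ω₁ ω₂ s : ℂ} {R : Set ℂ} (h : 0 < (ω₂ / ω₁).im)
    (hR : IsPinning (latticeSpan ω₁ ω₂) s R) {g F : ℂ → ℂ} {ν : ℂ → ℤ}
    (hg : IsElliptic (latticeSpan ω₁ ω₂) g) (hν : ∀ α, HasIntResidueAt F α (ν α))
    (hgF : ∀ α, ∀ᶠ z in 𝓝[≠] α, F z = g (z + s) - g z) (α : ℂ) :
    ∃ n, HasIntResidueAt g α n := by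
  classical
  have hper : ∀ l ∈ latticeSpan ω₁ ω₂, ∀ β, ∀ n, HasIntResidueAt g (β + l) n ↔
      HasIntResidueAt g β n := fun l hl β n => by
    rw [← hasIntResidueAt_comp_add, hasIntResidueAt_congr (hg.eventually_add_eq hl β)]
  obtain ⟨R₀, N₀, -, hN₀⟩ := hR.exists_finset h
    (ρ := fun z => if HasIntResidueAt g z 0 then 0 else 1)
    (fun l hl β => by simp only [hper l hl β]) (fun β => by
      filter_upwards [(hg.1 β (mem_univ β)).eventually_analyticAt] with z hz
      rw [if_pos hz.hasIntResidueAt])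
  have hstep : ∀ β, (∃ n, HasIntResidueAt g β n) → ∃ n, HasIntResidueAt g (β + s) n := by
    rintro β ⟨n, hn⟩
    refine ⟨n + ν β, ?_⟩
    rw [← hasIntResidueAt_comp_add, hasIntResidueAt_congr (G := fun z => g z + F z)
      ((hgF β).mono fun z hz => by rw [hz]; ring)]
    exact hn.add (hν β)
  obtain ⟨⟨r, n, l⟩, ⟨hr, hl, rfl⟩, -⟩ := hR α
  dsimp only at hr hl ⊢
  simp only [hper l hl]
  obtain ⟨m, hmn, hm⟩ : ∃ m ≤ n, m ∉ N₀ := by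
    obtain ⟨b, hb⟩ := N₀.finite_toSet.bddBelow
    refine ⟨min n (b - 1), min_le_left _ _, fun hmem => ?_⟩
    have := hb hmem
    have := min_le_right n (b - 1)
    omega
  have h0 : HasIntResidueAt g (r + m * s) 0 := by
    by_contra h0
    exact hm (hN₀ r hr m (by simp [h0])).2
  obtain ⟨k, rfl⟩ := Int.le.dest hmn
  clear hmn
  induction k with
  | zero => exact ⟨0, by simpa using h0⟩
  | succ k ih =>
    convert! hstep _ ih using 3
    push_cast
    ring

lemma finsum_eq_zero_of_sub_eq {ω₁ ω₂ s : ℂ} {R : Set ℂ} (h : 0 < (ω₂ / ω₁).im)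
    (hR : IsPinning (latticeSpan ω₁ ω₂) s R) {g F : ℂ → ℂ} {ν : ℂ → ℤ}
    (hg : IsElliptic (latticeSpan ω₁ ω₂) g) (hν : ∀ α, HasIntResidueAt F α (ν α))
    (hgF : ∀ α, ∀ᶠ z in 𝓝[≠] α, F z = g (z + s) - g z) :
    (∀ r ∈ R, (∑ᶠ n : ℤ, ν (r + n * s)) = 0) ∧
      (∑ᶠ r ∈ R, ∑ᶠ n : ℤ, n * ν (r + n * s)) = 0 := by
  choose ρ hρ using exists_hasIntResidueAt_of_sub_eq h hR hg hν hgF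
  have hper : ∀ l ∈ latticeSpan ω₁ ω₂, ∀ α, ∀ᶠ z in 𝓝[≠] α, g (z + l) = g z :=
    fun l hl α => hg.eventually_add_eq hl α
  have hρper : ∀ l ∈ latticeSpan ω₁ ω₂, ∀ α, ρ (α + l) = ρ α := fun l hl α =>
    HasIntResidueAt.add_mem_eq hρ hper hl α
  have hνρ : ∀ α, ν α = ρ (α + s) - ρ α := fun α => by
    refine (hν α).unique ?_
    rw [hasIntResidueAt_congr (hgF α)]
    exact ((hasIntResidueAt_comp_add s).2 (hρ (α + s))).sub (hρ α)
  obtain ⟨R₀, N₀, hR₀, hN₀⟩ := hR.exists_finset h hρper (HasIntResidueAt.eventually_eq_zero hρ)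
  obtain ⟨κ, T, hT⟩ := exists_isTheta h
  have hsum : ∑ p ∈ R₀ ×ˢ N₀, ρ (p.1 + p.2 * s) = 0 := by
    exact (hT.residue_sum_eq_zero_and_expansion h hρ hper (R₀ ×ˢ N₀)
      (fun p => p.1 + p.2 * s) (hR.injOn_finset hR₀) (hR.exists_mem_finset hρper hN₀)).1
  have hfin : ∀ r ∈ R, (Function.support fun n : ℤ => ρ (r + n * s)).Finite := fun r hr =>
    N₀.finite_toSet.subset fun n hn => (hN₀ r hr n hn).2
  have hshift : ∀ (r : ℂ) (n : ℤ),
      ν (r + n * s) = ρ (r + (n + 1 : ℤ) * s) - ρ (r + n * s) := fun r n => by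
    rw [hνρ]
    congr 2
    push_cast
    ring
  simp only [hshift]
  refine ⟨fun r hr => finsum_shift_sub (fun n => ρ (r + n * s)) (hfin r hr), ?_⟩
  rw [finsum_mem_congr rfl fun r hr =>
    finsum_mul_shift_sub (fun n => ρ (r + n * s)) (hfin r hr)]
  simp_rw [← finsum_neg_distrib]
  rw [finsum_mem_finsum_eq_sum hR₀ (c := fun r n => -ρ (r + n * s))
    fun r hr n hn => hN₀ r hr n (neg_ne_zero.1 hn), Finset.sum_neg_distrib, hsum, neg_zero]

/-! ### Sufficiency -/

lemma countable_compl_of_mem_codiscrete {U : Set ℂ} (hU : U ∈ codiscrete ℂ) : Uᶜ.Countable :=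
  (HereditarilyLindelofSpace.isLindelof _).countable_of_isDiscrete (mem_codiscrete'.1 hU).2

lemma isPreconnected_of_mem_codiscrete {U : Set ℂ} (hU : U ∈ codiscrete ℂ) :
    IsPreconnected U := by
  rw [← compl_compl U]
  exact ((countable_compl_of_mem_codiscrete hU).isConnected_compl_of_one_lt_rank
    (by simp)).isPreconnected

lemma mem_codiscrete_iff_eventually {U : Set ℂ} :
    U ∈ codiscrete ℂ ↔ ∀ α, ∀ᶠ z in 𝓝[≠] α, z ∈ U := by
  simp only [mem_codiscrete, disjoint_principal_right, compl_compl]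
  rfl

lemma eq_zero_of_exp_mul_eq_one {ω₁ ω₂ c : ℂ} (h : 0 < (ω₂ / ω₁).im)
    (h₁ : Complex.exp (c * ω₁) = 1) (h₂ : Complex.exp (c * ω₂) = 1) : c = 0 := by
  have hω₁ : ω₁ ≠ 0 := by rintro rfl; simp at h
  by_contra hc
  obtain ⟨m, hm⟩ := Complex.exp_eq_one_iff.1 h₁
  obtain ⟨n, hn⟩ := Complex.exp_eq_one_iff.1 h₂
  have ht : ω₂ / ω₁ = ((n / m : ℝ) : ℂ) := by
    rw [← mul_div_mul_left _ _ hc, hm, hn, mul_div_mul_right _ _ Complex.two_pi_I_ne_zero]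
    push_cast
    rfl
  rw [ht, Complex.ofReal_im] at h
  exact lt_irrefl _ h

lemma IsTheta.prod_zpow_add_left {ω₁ ω₂ κ : ℂ} {T : ℂ → ℂ} (hT : IsTheta ω₁ ω₂ κ T)
    {ι : Type*} (A : Finset ι) (a : ι → ℂ) (ν : ι → ℤ) (z : ℂ) :
    ∏ i ∈ A, T (z + ω₁ - a i) ^ ν i = ∏ i ∈ A, T (z - a i) ^ ν i :=
  Finset.prod_congr rfl fun i _ => by rw [add_sub_right_comm, hT.add_left]

lemma IsTheta.prod_zpow_add_right {ω₁ ω₂ κ : ℂ} {T : ℂ → ℂ} (hT : IsTheta ω₁ ω₂ κ T)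
    {ι : Type*} (A : Finset ι) (a : ι → ℂ) (ν : ι → ℤ) (h0 : ∑ i ∈ A, ν i = 0)
    (h1 : ∑ i ∈ A, ν i * a i = 0) (z : ℂ) :
    ∏ i ∈ A, T (z + ω₂ - a i) ^ ν i = ∏ i ∈ A, T (z - a i) ^ ν i := by
  have h0' : ∑ i ∈ A, (ν i : ℂ) = 0 := by exact_mod_cast h0
  have hexp : ∑ i ∈ A, (ν i : ℂ) * (Real.pi * Complex.I - κ * (z - a i)) = 0 := by
    calc _ = ∑ i ∈ A, ((ν i : ℂ) * (Real.pi * Complex.I - κ * z) + κ * (ν i * a i)) :=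
          Finset.sum_congr rfl fun i _ => by ring
      _ = 0 := by rw [Finset.sum_add_distrib, ← Finset.sum_mul, ← Finset.mul_sum, h0', h1]; simp
  simp_rw [add_sub_right_comm, hT.add_right, mul_zpow, ← Complex.exp_int_mul]
  rw [Finset.prod_mul_distrib, ← Complex.exp_sum, hexp, Complex.exp_zero, one_mul]

/-- The additive constant in the expansion of the logarithmic derivative of an elliptic function
vanishes when the divisor sums to zero in `ℂ`. -/
lemma IsTheta.const_eq_zero {ω₁ ω₂ κ : ℂ} {T : ℂ → ℂ} (h : 0 < (ω₂ / ω₁).im)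
    (hT : IsTheta ω₁ ω₂ κ T) {f : ℂ → ℂ}
    (hf : ∀ α, ∀ᶠ z in 𝓝[≠] α, AnalyticAt ℂ f z ∧ f z ≠ 0)
    (hper : ∀ l ∈ latticeSpan ω₁ ω₂, ∀ α, ∀ᶠ z in 𝓝[≠] α, f (z + l) = f z)
    {ι : Type*} (A : Finset ι) (a : ι → ℂ) (ν : ι → ℤ) {c : ℂ}
    (hexp : ∀ α, ∀ᶠ z in 𝓝[≠] α, logDeriv f z = c + ∑ i ∈ A, ν i * logDeriv T (z - a i))
    (h0 : ∑ i ∈ A, ν i = 0) (h1 : ∑ i ∈ A, ν i * a i = 0) : c = 0 := by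
  set U : Set ℂ := {z | (AnalyticAt ℂ f z ∧ f z ≠ 0) ∧ ∀ i ∈ A, T (z - a i) ≠ 0} with hU
  have hUev : ∀ α, ∀ᶠ z in 𝓝[≠] α, z ∈ U := fun α =>
    (hf α).and (hT.eventually_forall_sub_ne_zero A a α)
  have hUcod := mem_codiscrete_iff_eventually.2 hUev
  set G : ℂ → ℂ := fun z => Complex.exp (c * z) * ∏ i ∈ A, T (z - a i) ^ ν i with hG
  have hTd : ∀ i z, DifferentiableAt ℂ (fun z => T (z - a i)) z := fun i z =>
    (hT.differentiable.fun_comp (by fun_prop : Differentiable ℂ fun z => z - a i)).differentiableAt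
  have hTz : ∀ z ∈ U, ∀ i ∈ A, DifferentiableAt ℂ (fun z => T (z - a i) ^ ν i) z :=
    fun z hz i hi => (hTd i z).zpow (Or.inl (hz.2 i hi))
  have hP : ∀ z ∈ U, DifferentiableAt ℂ (fun z => ∏ i ∈ A, T (z - a i) ^ ν i) z :=
    fun z hz => DifferentiableAt.fun_finsetProd fun i hi => hTz z hz i hi
  have hE : ∀ z, HasDerivAt (fun z => Complex.exp (c * z)) (Complex.exp (c * z) * c) z :=
    fun z => by simpa only [id, mul_one] using ((hasDerivAt_id z).const_mul c).cexp
  have hP0 : ∀ z ∈ U, ∏ i ∈ A, T (z - a i) ^ ν i ≠ 0 := fun z hz =>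
    Finset.prod_ne_zero_iff.2 fun i hi => zpow_ne_zero _ (hz.2 i hi)
  have hG0 : ∀ z ∈ U, G z ≠ 0 := fun z hz => mul_ne_zero (Complex.exp_ne_zero _) (hP0 z hz)
  have hGl : ∀ z ∈ U, logDeriv G z = c + ∑ i ∈ A, ν i * logDeriv T (z - a i) := fun z hz => by
    rw [hG, logDeriv_mul (f := fun z => Complex.exp (c * z)) z (Complex.exp_ne_zero _)
      (hP0 z hz) (hE z).differentiableAt (hP z hz), logDeriv_apply, (hE z).deriv,
      mul_div_cancel_left₀ _ (Complex.exp_ne_zero _)]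
    congr 1
    rw [logDeriv_prod (s := A) (f := fun i z => T (z - a i) ^ ν i)
      (fun i hi => zpow_ne_zero _ (hz.2 i hi)) (fun i hi => hTz z hz i hi)]
    refine Finset.sum_congr rfl fun i _ => ?_
    rw [logDeriv_fun_zpow (hTd i z), logDeriv_apply, logDeriv_apply, deriv_comp_sub_const]
  have hfl : ∀ z ∈ U, logDeriv f z = c + ∑ i ∈ A, ν i * logDeriv T (z - a i) := fun z hz => by
    refine ContinuousAt.eq_of_eventuallyEq_nhdsNE (F := logDeriv f)
      (G := fun z => c + ∑ i ∈ A, ν i * logDeriv T (z - a i)) ?_ ?_ (hexp z)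
    · exact (hz.1.1.deriv.div hz.1.1 hz.1.2).continuousAt
    · refine continuousAt_const.add (tendsto_finsetSum _ fun i hi => ?_)
      have hTa := hT.differentiable.analyticAt (z - a i)
      have hZ : ContinuousAt (logDeriv T) (z - a i) :=
        (hTa.deriv.div hTa (hz.2 i hi)).continuousAt
      exact continuousAt_const.mul (ContinuousAt.comp' (f := fun z => z - a i) hZ (by fun_prop))
  obtain ⟨C, -, hC⟩ := (logDeriv_eqOn_iff (f := f) (g := G) (s := U)
    (fun z hz => hz.1.1.differentiableAt.differentiableWithinAt)
    (fun z hz => ((hE z).differentiableAt.mul (hP z hz)).differentiableWithinAt)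
    (mem_codiscrete'.1 hUcod).1 (isPreconnected_of_mem_codiscrete hUcod) hG0
    (fun z hz => hz.1.2)).1 fun z hz => by rw [hfl z hz, hGl z hz]
  obtain ⟨z, hz, hz₁, hz₂, hf₁, hf₂⟩ := ((hUev 0).and (((eventually_nhdsNE_add ω₁).1 (hUev _)).and
    (((eventually_nhdsNE_add ω₂).1 (hUev _)).and ((hper ω₁ (latticeSpan_left_mem _ _) 0).and
      (hper ω₂ (latticeSpan_right_mem _ _) 0))))).exists
  have key : ∀ l, z + l ∈ U → f (z + l) = f z →
      ∏ i ∈ A, T (z + l - a i) ^ ν i = ∏ i ∈ A, T (z - a i) ^ ν i → Complex.exp (c * l) = 1 := by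
    intro l hl hfl hprod
    have hGE : G (z + l) = Complex.exp (c * l) * G z := by
      rw [hG]
      simp only [hprod, mul_add, Complex.exp_add]
      ring
    rw [hC hl, Pi.smul_apply, smul_eq_mul, hGE, mul_left_comm, ← smul_eq_mul C (G z),
      ← Pi.smul_apply, ← hC hz] at hfl
    exact (mul_eq_right₀ hz.1.2).1 hfl
  exact eq_zero_of_exp_mul_eq_one h (key ω₁ hz₁ hf₁ (hT.prod_zpow_add_left A a ν z))
    (key ω₂ hz₂ hf₂ (hT.prod_zpow_add_right A a ν h0 h1 z))

/-- A meromorphic function whose difference along `s` is a difference of two translates of the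
logarithmic derivative of the theta function. -/
lemma IsTheta.exists_telescope {ω₁ ω₂ κ : ℂ} {T : ℂ → ℂ} (hT : IsTheta ω₁ ω₂ κ T) (s : ℂ) (n : ℤ) :
    ∃ W : ℂ → ℂ, (∀ z, MeromorphicAt W z) ∧
      (∀ z, W (z + s) - W z = logDeriv T (z - n * s) - logDeriv T z) ∧
      (∀ z, W (z + ω₁) = W z) ∧ ∀ α, ∀ᶠ z in 𝓝[≠] α, W (z + ω₂) = W z + n * κ := by
  have hZm : ∀ (b z : ℂ), MeromorphicAt (fun z => logDeriv T (z - b)) z := fun b z => by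
    have hTb : AnalyticAt ℂ (fun z => T (z - b)) z :=
      AnalyticAt.fun_comp (hT.differentiable.analyticAt _) (by fun_prop)
    refine (hTb.deriv.meromorphicAt.div hTb.meromorphicAt).congr (Eventually.of_forall fun w => ?_)
    simp only [Pi.div_apply, logDeriv_apply, deriv_comp_sub_const]
  have hZ₁ : ∀ b z, logDeriv T (z + ω₁ - b) = logDeriv T (z - b) := fun b z => by
    rw [add_sub_right_comm, hT.logDeriv_add_left]
  have hZ₂ : ∀ b α, ∀ᶠ z in 𝓝[≠] α, logDeriv T (z + ω₂ - b) = logDeriv T (z - b) - κ :=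
    fun b α => by
      filter_upwards [hT.eventually_forall_sub_ne_zero {()} (fun _ => b) α] with z hz
      rw [add_sub_right_comm, hT.logDeriv_add_right (hz () (by simp))]
  induction n using Int.induction_on with
  | zero => exact ⟨fun _ => 0, fun z => MeromorphicAt.const 0 z, by simp, by simp, by simp⟩
  | succ n ih =>
    obtain ⟨W, hW, hs, h₁, h₂⟩ := ih
    refine ⟨fun z => W z - logDeriv T (z - (n + 1) * s), fun z => (hW z).fun_sub (hZm _ z),
      fun z => ?_, fun z => by simp only [h₁, hZ₁], fun α => ?_⟩
    · have e : z + s - (n + 1) * s = z - n * s := by ring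
      have := hs z
      push_cast at this ⊢
      rw [e]
      linear_combination this
    · filter_upwards [h₂ α, hZ₂ ((n + 1) * s) α] with z h3 h4
      rw [h3, h4]
      push_cast
      ring
  | pred n ih =>
    obtain ⟨W, hW, hs, h₁, h₂⟩ := ih
    refine ⟨fun z => W z + logDeriv T (z - (-n) * s), fun z => (hW z).fun_add (hZm _ z),
      fun z => ?_, fun z => by simp only [h₁, hZ₁], fun α => ?_⟩
    · have e : z + s - (-n) * s = z - (-n - 1) * s := by ring
      have := hs z
      push_cast at this ⊢
      rw [e]
      linear_combination this
    · filter_upwards [h₂ α, hZ₂ ((-n) * s) α] with z h3 h4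
      rw [h3, h4]
      push_cast
      ring

/-- A meromorphic function that is periodic and solves the difference equation away from a discrete
set can be modified on a discrete set to witness elliptic summability. -/
lemma ellSummable_logDeriv_of_eventually {ω₁ ω₂ s : ℂ} {f g : ℂ → ℂ}
    (hf : IsElliptic (latticeSpan ω₁ ω₂) f)
    (hf0 : ∀ α, ∀ᶠ z in 𝓝[≠] α, AnalyticAt ℂ f z ∧ f z ≠ 0) (hg : ∀ z, MeromorphicAt g z)
    (h₁ : ∀ α, ∀ᶠ z in 𝓝[≠] α, g (z + ω₁) = g z) (h₂ : ∀ α, ∀ᶠ z in 𝓝[≠] α, g (z + ω₂) = g z)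
    (hfg : ∀ α, ∀ᶠ z in 𝓝[≠] α, logDeriv f z = g (z + s) - g z) :
    EllSummable (latticeSpan ω₁ ω₂) s (logDeriv f) := by
  classical
  set p : ℂ → Prop := fun z => AnalyticAt ℂ f z ∧ f z ≠ 0 with hp
  have hpl : ∀ l ∈ latticeSpan ω₁ ω₂, ∀ z, p z → p (z + l) := by
    rintro l hl z ⟨hz, hz0⟩
    have hz' : AnalyticAt ℂ (fun w => f (w + l)) z :=
      hz.congr (by filter_upwards [hz.eventually_analyticAt] with w hw using (hf.2 l hl w hw).symm)
    refine ⟨?_, by rwa [hf.2 l hl z hz]⟩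
    have := AnalyticAt.fun_comp (f := fun w => w - l) (x := z + l) (g := fun w => f (w + l))
      (by simpa using hz') (by fun_prop)
    simpa using this
  have hpl' : ∀ l ∈ latticeSpan ω₁ ω₂, ∀ z, p (z + l) ↔ p z := fun l hl z =>
    ⟨fun h => by simpa using hpl _ (latticeSpan_neg_mem hl) _ h, hpl l hl z⟩
  set u : ℂ → ℂ := fun z => limUnder (𝓝[≠] z) g with hu
  have hug : ∀ z, AnalyticAt ℂ g z → u z = g z := fun z hz =>
    (hz.continuousAt.tendsto.mono_left nhdsWithin_le_nhds).limUnder_eq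
  have hul : ∀ l, (∀ α, ∀ᶠ z in 𝓝[≠] α, g (z + l) = g z) → ∀ z, u (z + l) = u z := fun l hl z => by
    have : map g (𝓝[≠] (z + l)) = map g (𝓝[≠] z) := by
      ext V
      rw [mem_map, mem_map]
      change (∀ᶠ w in 𝓝[≠] (z + l), g w ∈ V) ↔ ∀ᶠ w in 𝓝[≠] z, g w ∈ V
      rw [eventually_nhdsNE_add]
      exact eventually_congr ((hl z).mono fun w hw => by rw [hw])
    simp only [hu, limUnder, this]
  set v : ℂ → ℂ := fun z => u z + if p z then 0 else 1 with hv
  have hvg : ∀ α, ∀ᶠ z in 𝓝[≠] α, v z = g z := fun α => by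
    filter_upwards [hf0 α, (hg α).eventually_analyticAt] with z h3 h4
    simp only [hv, hug z h4, if_pos (show p z from h3), add_zero]
  have hvp : ∀ z, AnalyticAt ℂ v z → p z := fun z hz => by
    by_contra hpz
    have h3 : Tendsto g (𝓝[≠] z) (𝓝 (v z)) :=
      (hz.continuousAt.tendsto.mono_left nhdsWithin_le_nhds).congr' (hvg z)
    have h4 : u z = v z := h3.limUnder_eq
    simp [hv, hpz] at h4
  refine ⟨v, ⟨fun z _ => (hg z).congr ((hvg z).mono fun w hw => hw.symm), fun l hl z _ => ?_⟩,
    fun z hz hzs => ?_⟩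
  · simp only [hv, hpl' l hl, eq_add_of_mem_latticeSpan (hul ω₁ h₁) (hul ω₂ h₂) hl z]
  · obtain ⟨hfz, hfz0⟩ := hvp z hz
    refine ContinuousAt.eq_of_eventuallyEq_nhdsNE (F := logDeriv f)
      (G := fun z => v (z + s) - v z) ?_ ?_ ?_
    · exact (hfz.deriv.div hfz hfz0).continuousAt
    · exact ContinuousAt.sub (ContinuousAt.comp' hzs.continuousAt (by fun_prop)) hz.continuousAt
    · filter_upwards [hfg z, hvg z, (eventually_nhdsNE_add s).1 (hvg (z + s))] with w h3 h4 h5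
      rw [h3, h4, h5]

/-- Sufficiency of the conditions, with the sums restricted to a finite set of orbits. -/
lemma IsTheta.ellSummable_logDeriv {ω₁ ω₂ κ : ℂ} {T : ℂ → ℂ} (h : 0 < (ω₂ / ω₁).im)
    (hT : IsTheta ω₁ ω₂ κ T) {s : ℂ} {f : ℂ → ℂ} (hf : IsElliptic (latticeSpan ω₁ ω₂) f)
    (hf0 : ∀ α, ∀ᶠ z in 𝓝[≠] α, AnalyticAt ℂ f z ∧ f z ≠ 0) (R₀ : Finset ℂ) (N₀ : Finset ℤ)
    (ν : ℂ → ℤ → ℤ) (hrow : ∀ r ∈ R₀, ∑ n ∈ N₀, ν r n = 0)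
    (htot : ∑ p ∈ R₀ ×ˢ N₀, p.2 * ν p.1 p.2 = 0) {c : ℂ}
    (hexp : ∀ α, ∀ᶠ z in 𝓝[≠] α, logDeriv f z =
      c + ∑ p ∈ R₀ ×ˢ N₀, ν p.1 p.2 * logDeriv T (z - (p.1 + p.2 * s))) :
    EllSummable (latticeSpan ω₁ ω₂) s (logDeriv f) := by
  have hweight : ∀ φ : ℂ → ℂ, ∑ p ∈ R₀ ×ˢ N₀, (ν p.1 p.2 : ℂ) * φ p.1 = 0 := fun φ => by
    rw [Finset.sum_product]
    refine Finset.sum_eq_zero fun r hr => ?_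
    dsimp only
    rw [← Finset.sum_mul, ← Int.cast_sum, hrow r hr, Int.cast_zero, zero_mul]
  have htot' : ∑ p ∈ R₀ ×ˢ N₀, (ν p.1 p.2 : ℂ) * p.2 = 0 := by
    simp_rw [mul_comm]
    exact_mod_cast htot
  have hc : c = 0 := by
    refine hT.const_eq_zero h hf0 (fun l hl => hf.eventually_add_eq hl) (R₀ ×ˢ N₀)
      (fun p => p.1 + p.2 * s) (fun p => ν p.1 p.2) hexp ?_ ?_
    · exact_mod_cast (by simpa using hweight fun _ => 1 :
        ∑ p ∈ R₀ ×ˢ N₀, (ν p.1 p.2 : ℂ) = 0)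
    · simp_rw [mul_add, ← mul_assoc]
      rw [Finset.sum_add_distrib, ← Finset.sum_mul, htot', hweight fun r => r]
      simp
  choose W hW hs h₁ h₂ using hT.exists_telescope s
  refine ellSummable_logDeriv_of_eventually
    (g := fun z => ∑ p ∈ R₀ ×ˢ N₀, ν p.1 p.2 * W p.2 (z - p.1)) hf hf0 (fun z => ?_)
    (fun α => Eventually.of_forall fun z => ?_) (fun α => ?_) fun α => ?_
  · exact MeromorphicAt.fun_sum fun p _ => (MeromorphicAt.const _ z).mul
      ((hW p.2 (z - p.1)).comp_analyticAt (f := W p.2) (g := fun z => z - p.1) (by fun_prop))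
  · simp only [add_sub_right_comm, h₁]
  · have hW₂ : ∀ᶠ z in 𝓝[≠] α, ∀ p ∈ R₀ ×ˢ N₀,
        W p.2 (z - p.1 + ω₂) = W p.2 (z - p.1) + p.2 * κ := by
      rw [Filter.eventually_all_finset]
      intro p _
      have := h₂ p.2 (α + -p.1)
      rw [eventually_nhdsNE_add] at this
      simpa only [← sub_eq_add_neg] using this
    filter_upwards [hW₂] with z hz
    have : ∀ p ∈ R₀ ×ˢ N₀, (ν p.1 p.2 : ℂ) * W p.2 (z + ω₂ - p.1) =
        ν p.1 p.2 * W p.2 (z - p.1) + ν p.1 p.2 * p.2 * κ := fun p hp => by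
      rw [add_sub_right_comm, hz p hp]
      ring
    rw [Finset.sum_congr rfl this, Finset.sum_add_distrib, ← Finset.sum_mul, htot', zero_mul,
      add_zero]
  · filter_upwards [hexp α] with z hz
    have : ∀ p ∈ R₀ ×ˢ N₀, (ν p.1 p.2 : ℂ) * W p.2 (z + s - p.1) - ν p.1 p.2 * W p.2 (z - p.1) =
        ν p.1 p.2 * logDeriv T (z - (p.1 + p.2 * s)) - ν p.1 p.2 * logDeriv T (z - p.1) :=
      fun p _ => by rw [add_sub_right_comm, ← mul_sub, hs, mul_sub, sub_sub]
    rw [hz, hc, zero_add, ← Finset.sum_sub_distrib, Finset.sum_congr rfl this,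
      Finset.sum_sub_distrib, hweight fun r => logDeriv T (z - r), sub_zero]

lemma IsLattice.exists_eq_latticeSpan {L : Set ℂ} (hL : IsLattice L) :
    ∃ ω₁ ω₂ : ℂ, 0 < (ω₂ / ω₁).im ∧ L = latticeSpan ω₁ ω₂ := by
  obtain ⟨ω₁, ω₂, hli, rfl⟩ := hL
  rw [LinearIndependent.pair_iff] at hli
  have hω₁ : ω₁ ≠ 0 := by
    rintro rfl
    simpa using hli 1 0
  have him : (ω₂ / ω₁).im ≠ 0 := fun h0 => by
    have hr : ω₂ / ω₁ = ((ω₂ / ω₁).re : ℂ) := Complex.ext rfl (by simpa using h0)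
    rw [div_eq_iff hω₁] at hr
    have := hli (-(ω₂ / ω₁).re) 1 (by
      rw [one_smul, Complex.real_smul, Complex.ofReal_neg, neg_mul, ← hr, neg_add_cancel])
    exact one_ne_zero this.2
  rcases lt_or_gt_of_ne him with h | h
  · refine ⟨ω₁, -ω₂, by simpa [neg_div] using h, Set.ext fun z => ⟨?_, ?_⟩⟩
    · rintro ⟨m, n, rfl⟩
      exact ⟨m, -n, by simp⟩
    · rintro ⟨m, n, rfl⟩
      exact ⟨m, -n, by simp⟩
  · exact ⟨ω₁, ω₂, h, rfl⟩

lemma HasOrderAt.eventually_analyticAt_and_ne_zero {f : ℂ → ℂ} {α : ℂ} {d : ℤ}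
    (h : HasOrderAt f α d) : ∀ᶠ z in 𝓝[≠] α, AnalyticAt ℂ f z ∧ f z ≠ 0 := by
  obtain ⟨g, hg, hg0, hfg⟩ := h
  filter_upwards [eventually_nhdsNE_eventually_nhds hfg, self_mem_nhdsWithin,
    hg.eventually_analyticAt.filter_mono nhdsWithin_le_nhds,
    (hg.continuousAt.eventually_ne hg0).filter_mono nhdsWithin_le_nhds] with z h1 hz h2 h3
  have hz' : z - α ≠ 0 := sub_ne_zero.2 hz
  refine ⟨?_, by rw [h1.self_of_nhds]; exact mul_ne_zero (zpow_ne_zero _ hz') h3⟩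
  have h4 : AnalyticAt ℂ (fun w => (w - α) ^ d * g w) z :=
    ((analyticAt_id.sub analyticAt_const).fun_zpow hz').mul h2
  exact h4.congr (h1.mono fun w hw => hw.symm)

theorem stmt16 (L : Set ℂ) (hL : IsLattice L) (s : ℂ)
    (hs : ∀ n : ℕ, 1 ≤ n → (n : ℂ) * s ∉ L)
    (R : Set ℂ) (hR : IsPinning L s R)
    (f : ℂ → ℂ) (hf : IsElliptic L f) (hf0 : ∃ z : ℂ, f z ≠ 0)
    (ν : ℂ → ℤ) (hν : ∀ α : ℂ, HasOrderAt f α (ν α)) :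
    EllSummable L s (fun z => deriv f z / f z) ↔
      ((∀ r ∈ R, (∑ᶠ n : ℤ, ν (r + (n : ℂ) * s)) = 0) ∧
        (∑ᶠ r ∈ R, ∑ᶠ n : ℤ, n * ν (r + (n : ℂ) * s)) = 0) := by
  obtain ⟨ω₁, ω₂, h, rfl⟩ := hL.exists_eq_latticeSpan
  have hres : ∀ α, HasIntResidueAt (logDeriv f) α (ν α) := fun α =>
    (hν α).hasIntResidueAt_logDeriv
  constructor
  · rintro ⟨g, hg, hfg⟩
    refine finsum_eq_zero_of_sub_eq h hR hg hres fun α => ?_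
    filter_upwards [(hg.1 α (mem_univ α)).eventually_analyticAt,
      (eventually_nhdsNE_add s).1 (hg.1 (α + s) (mem_univ _)).eventually_analyticAt]
      with z h1 h2 using hfg z h1 h2
  · rintro ⟨hrow, htot⟩
    have hper : ∀ l ∈ latticeSpan ω₁ ω₂, ∀ α, ∀ᶠ z in 𝓝[≠] α, logDeriv f (z + l) = logDeriv f z :=
      fun l hl α => hf.eventually_logDeriv_add_eq hl α
    have hνper : ∀ l ∈ latticeSpan ω₁ ω₂, ∀ α, ν (α + l) = ν α := fun l hl α =>
      HasIntResidueAt.add_mem_eq hres hper hl α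
    obtain ⟨R₀, N₀, hR₀, hN₀⟩ := hR.exists_finset h hνper
      (HasIntResidueAt.eventually_eq_zero hres)
    obtain ⟨κ, T, hT⟩ := exists_isTheta h
    obtain ⟨-, c, hc⟩ := hT.residue_sum_eq_zero_and_expansion h hres hper (R₀ ×ˢ N₀)
      (fun p => p.1 + p.2 * s) (hR.injOn_finset hR₀) (hR.exists_mem_finset hνper hN₀)
    refine hT.ellSummable_logDeriv h hf (fun α => (hν α).eventually_analyticAt_and_ne_zero)
      R₀ N₀ (fun r n => ν (r + n * s)) (fun r hr => ?_) ?_ hc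
    · rw [← finsum_eq_sum_of_ne_zero_imp_mem (c := fun r n => ν (r + n * s)) hN₀ (hR₀ hr)]
      exact hrow r (hR₀ hr)
    · rw [← finsum_mem_finsum_eq_sum hR₀ (c := fun r n => n * ν (r + n * s))
        fun r hr n hn => hN₀ r hr n (right_ne_zero_of_mul hn)]
      exact htot
end
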